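/- arXiv:2312.08340 — 3 statements merged into one kernel-verified Lean document; each statement's English description precedes it below -/
import Mathlib

section
/- For every α > 0 and every ε > 0 there exists k₀ such that for every integer k ≥ k₀ there exists a finite k-regular simple graph G with the property that the colouring number of the random subgraph G_{1/2} satisfies P(𝒞(G_{1/2}) ≤ k/3 + α·k) ≥ 1 − ε. (In particular, the largest function 𝔇(k) such that every graph of minimum degree at least k satisfies P(𝒞(G_{1/2}) ≥ 𝔇(k)) ≥ 1/2 obeys 𝔇(k) ≤ k/3 + o(k) as k → ∞.) -/
open scoped Classical

/-- Probability, for the random subgraph of `G` in which each edge of `G` is retained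
independently with probability `p`, of the event `A`. -/
noncomputable def subgraphProb {V : Type} [Fintype V] (G : SimpleGraph V)
    (p : ℝ) (A : SimpleGraph V → Prop) : ℝ :=
  ∑ s ∈ G.edgeSet.toFinset.powerset,
    (if A (SimpleGraph.fromEdgeSet ↑s) then
      p ^ s.card * (1 - p) ^ (G.edgeSet.toFinset.card - s.card) else 0)

/-- The colouring number of `H`: the least `t` such that every nonempty subgraph of `H`
has a vertex of degree less than `t` (it suffices to consider induced subgraphs, on a
nonempty vertex set `s`; the degree of `v ∈ s` there is the number of neighbours of `v` in `s`). -/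
noncomputable def coloringNumber {V : Type} [Fintype V] (H : SimpleGraph V) : ℕ :=
  sInf {t : ℕ | ∀ s : Finset V, s.Nonempty → ∃ v ∈ s, (s.filter (fun u => H.Adj v u)).card < t}

section UniformSubset

variable {ι κ : Type}

/-- Probability that a uniformly random subset of `E` satisfies `A`. -/
noncomputable def subsetProb (E : Finset ι) (A : Finset ι → Prop) : ℝ :=
  (∑ s ∈ E.powerset, if A s then (1 : ℝ) else 0) / 2 ^ E.card

lemma subsetProb_mono {E : Finset ι} {A B : Finset ι → Prop}
    (h : ∀ s ⊆ E, A s → B s) : subsetProb E A ≤ subsetProb E B := by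
  unfold subsetProb
  gcongr with s hs
  have := h s (Finset.mem_powerset.1 hs)
  by_cases hA : A s
  · simp [hA, this hA]
  · simp only [hA, if_false]; positivity

lemma subsetProb_add_not (E : Finset ι) (A : Finset ι → Prop) :
    subsetProb E A + subsetProb E (fun s => ¬ A s) = 1 := by
  unfold subsetProb
  rw [← add_div, ← Finset.sum_add_distrib]
  rw [Finset.sum_congr rfl (g := fun _ => (1 : ℝ))]
  · simp
  · intro s _
    by_cases hA : A s <;> simp [hA]

lemma subsetProb_or_le (E : Finset ι) (A B : Finset ι → Prop) :
    subsetProb E (fun s => A s ∨ B s) ≤ subsetProb E A + subsetProb E B := by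
  unfold subsetProb
  rw [← add_div, ← Finset.sum_add_distrib]
  gcongr with s
  by_cases hA : A s <;> by_cases hB : B s <;> simp [hA, hB]

lemma subsetProb_exists_le (E : Finset ι) (T : Finset κ) (A : κ → Finset ι → Prop) :
    subsetProb E (fun s => ∃ a ∈ T, A a s) ≤ ∑ a ∈ T, subsetProb E (A a) := by
  unfold subsetProb
  rw [← Finset.sum_div, Finset.sum_comm]
  gcongr with s
  split_ifs with h
  · obtain ⟨a, ha, hA⟩ := h
    calc (1 : ℝ) = if A a s then (1 : ℝ) else 0 := by simp [hA]
      _ ≤ _ := Finset.single_le_sum (f := fun a => if A a s then (1 : ℝ) else 0)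
        (fun _ _ => by positivity) ha
  · exact Finset.sum_nonneg fun _ _ => by positivity

lemma sum_powerset_exp_card (D : Finset ι) (c : ℝ) :
    ∑ t ∈ D.powerset, Real.exp (c * t.card) = (1 + Real.exp c) ^ D.card := by
  have := Finset.prod_one_add (f := fun _ : ι => Real.exp c) D
  simp only [Finset.prod_const] at this
  rw [this]
  refine Finset.sum_congr rfl fun t _ => ?_
  rw [← Real.exp_nat_mul, mul_comm]

variable [DecidableEq ι]

lemma sum_powerset_split {D E : Finset ι} (h : D ⊆ E) (f : Finset ι → ℝ) :
    ∑ s ∈ E.powerset, f s = ∑ r ∈ (E \ D).powerset, ∑ t ∈ D.powerset, f (r ∪ t) := by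
  rw [← Finset.sum_product']
  refine Finset.sum_bij' (fun s _ => (s \ D, s ∩ D)) (fun x _ => x.1 ∪ x.2) ?_ ?_ ?_ ?_ ?_
  · intro s hs
    simp only [Finset.mem_product, Finset.mem_powerset] at hs ⊢
    exact ⟨Finset.sdiff_subset_sdiff hs subset_rfl, Finset.inter_subset_right⟩
  · rintro ⟨r, t⟩ hx
    simp only [Finset.mem_product, Finset.mem_powerset] at hx ⊢
    exact Finset.union_subset (hx.1.trans Finset.sdiff_subset) (hx.2.trans h)
  · intro s _
    exact Finset.sdiff_union_inter s D
  · rintro ⟨r, t⟩ hx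
    simp only [Finset.mem_product, Finset.mem_powerset] at hx
    ext a
    · have h1 := @hx.1 a
      have h2 := @hx.2 a
      simp only [Finset.mem_sdiff, Finset.mem_union] at h1 ⊢
      tauto
    · have h1 := @hx.1 a
      have h2 := @hx.2 a
      simp only [Finset.mem_sdiff, Finset.mem_union, Finset.mem_inter] at h1 ⊢
      tauto
  · intro s _
    simp [Finset.sdiff_union_inter]

/-- Hoeffding's inequality for a uniformly random subset. -/
lemma subsetProb_card_inter_le (E D : Finset ι) {n : ℕ} (hD : D.card ≤ n) {γ : ℝ} (hγ : 0 ≤ γ) :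
    subsetProb E (fun s => (1 / 2 + γ) * n ≤ (s ∩ D).card) ≤ Real.exp (-(2 * γ ^ 2 * n)) := by
  set c := 4 * γ with hc
  have key : ∑ s ∈ E.powerset, (if (1 / 2 + γ) * n ≤ ((s ∩ D).card : ℝ) then (1 : ℝ) else 0)
      ≤ Real.exp (-(c * ((1 / 2 + γ) * n))) *
        ∑ s ∈ E.powerset, Real.exp (c * (s ∩ D).card) := by
    rw [Finset.mul_sum]
    refine Finset.sum_le_sum fun s _ => ?_
    rw [← Real.exp_add]
    split_ifs with h
    · apply Real.one_le_exp
      have : c * ((1 / 2 + γ) * n) ≤ c * (s ∩ D).card := by gcongr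
      linarith
    · positivity
  have hsum : ∑ s ∈ E.powerset, Real.exp (c * (s ∩ D).card)
      = 2 ^ (E \ (E ∩ D)).card * (1 + Real.exp c) ^ (E ∩ D).card := by
    rw [sum_powerset_split (Finset.inter_subset_left : E ∩ D ⊆ E)]
    have : ∀ r ∈ (E \ (E ∩ D)).powerset, ∑ t ∈ (E ∩ D).powerset,
        Real.exp (c * ((r ∪ t) ∩ D).card) = (1 + Real.exp c) ^ (E ∩ D).card := by
      intro r hr
      rw [← sum_powerset_exp_card]
      refine Finset.sum_congr rfl fun t ht => ?_
      congr 4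
      rw [Finset.mem_powerset] at hr ht
      ext a
      have h1 := @hr a
      have h2 := @ht a
      simp only [Finset.mem_sdiff, Finset.mem_union, Finset.mem_inter] at h1 h2 ⊢
      tauto
    rw [Finset.sum_congr rfl this]
    simp
  have hcosh : 1 + Real.exp c ≤ 2 * Real.exp (c / 2 + c ^ 2 / 8) := by
    have h1 := Real.cosh_le_exp_half_sq (c / 2)
    rw [Real.cosh_eq] at h1
    have h2 : 1 + Real.exp c = Real.exp (c / 2) * (Real.exp (c / 2) + Real.exp (-(c / 2))) := by
      rw [mul_add, ← Real.exp_add, ← Real.exp_add]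
      ring_nf
      simp [add_comm]
    rw [h2, Real.exp_add]
    have h3 : Real.exp ((c / 2) ^ 2 / 2) = Real.exp (c ^ 2 / 8) := by ring_nf
    rw [h3] at h1
    nlinarith [Real.exp_pos (c / 2)]
  have hcard : (E \ (E ∩ D)).card + (E ∩ D).card = E.card :=
    Finset.card_sdiff_add_card_eq_card Finset.inter_subset_left
  have hn : (((E ∩ D).card : ℕ) : ℝ) ≤ n := by
    exact_mod_cast (Finset.card_le_card Finset.inter_subset_right).trans hD
  unfold subsetProb
  rw [div_le_iff₀ (by positivity)]
  refine key.trans ?_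
  rw [hsum]
  calc Real.exp (-(c * ((1 / 2 + γ) * n))) * (2 ^ (E \ (E ∩ D)).card *
        (1 + Real.exp c) ^ (E ∩ D).card)
      ≤ Real.exp (-(c * ((1 / 2 + γ) * n))) * (2 ^ (E \ (E ∩ D)).card *
        (2 * Real.exp (c / 2 + c ^ 2 / 8)) ^ (E ∩ D).card) := by gcongr
    _ = Real.exp (-(c * ((1 / 2 + γ) * n)) + (E ∩ D).card * (c / 2 + c ^ 2 / 8))
        * 2 ^ E.card := by
      rw [mul_pow, ← hcard, pow_add, Real.exp_add _ (_ * _), Real.exp_nat_mul]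
      ring
    _ ≤ Real.exp (-(2 * γ ^ 2 * n)) * 2 ^ E.card := by
      gcongr
      have : ((E ∩ D).card : ℝ) * (c / 2 + c ^ 2 / 8) ≤ n * (c / 2 + c ^ 2 / 8) := by gcongr
      rw [hc] at this ⊢
      nlinarith

/-- If each of many events depending on disjoint sets has probability at least `q`, then it is
unlikely that none of them occurs. -/
lemma subsetProb_forall_not_le [DecidableEq κ] (I : Finset κ) (D : κ → Finset ι)
    (A : κ → Finset ι → Prop)
    (q : ℝ) (hq : q ≤ 1) (hdisj : ∀ i ∈ I, ∀ j ∈ I, i ≠ j → Disjoint (D i) (D j))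
    (hA : ∀ i ∈ I, ∀ s, A i s ↔ A i (s ∩ D i))
    (hprob : ∀ i ∈ I, q ≤ subsetProb (D i) (A i)) (E : Finset ι) (hE : ∀ i ∈ I, D i ⊆ E) :
    subsetProb E (fun s => ∀ i ∈ I, ¬ A i s) ≤ (1 - q) ^ I.card := by
  induction I using Finset.induction_on generalizing E with
  | empty => simp [subsetProb]
  | insert j I hj ih =>
    have hDj := hE j (Finset.mem_insert_self j I)
    have hIH := ih (fun i hi k hk => hdisj i (Finset.mem_insert_of_mem hi) k
      (Finset.mem_insert_of_mem hk)) (fun i hi => hA i (Finset.mem_insert_of_mem hi))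
      (fun i hi => hprob i (Finset.mem_insert_of_mem hi)) (E \ D j) (fun i hi =>
        Finset.subset_sdiff.2 ⟨hE i (Finset.mem_insert_of_mem hi),
          hdisj i (Finset.mem_insert_of_mem hi) j (Finset.mem_insert_self j I)
            (fun h => hj (h ▸ hi))⟩)
    have hnot : subsetProb (D j) (fun s => ¬ A j s) ≤ 1 - q := by
      have h1 := subsetProb_add_not (D j) (A j)
      have h2 := hprob j (Finset.mem_insert_self j I)
      linarith
    have hprod : subsetProb E (fun s => ∀ i ∈ insert j I, ¬ A i s) =
        subsetProb (E \ D j) (fun s => ∀ i ∈ I, ¬ A i s) *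
          subsetProb (D j) (fun s => ¬ A j s) := by
      unfold subsetProb
      rw [div_mul_div_comm, ← pow_add, Finset.card_sdiff_add_card_eq_card hDj,
        sum_powerset_split hDj, Finset.sum_mul_sum]
      congr 1
      refine Finset.sum_congr rfl fun r hr => Finset.sum_congr rfl fun t ht => ?_
      rw [Finset.mem_powerset] at hr ht
      have h1 : A j (r ∪ t) ↔ A j t := by
        rw [hA j (Finset.mem_insert_self j I), hA j (Finset.mem_insert_self j I) t]
        have : (r ∪ t) ∩ D j = t ∩ D j := by
          ext a
          have h1 := @hr a
          simp only [Finset.mem_sdiff, Finset.mem_union, Finset.mem_inter] at h1 ⊢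
          tauto
        rw [this]
      have h2 : ∀ i ∈ I, (A i (r ∪ t) ↔ A i r) := by
        intro i hi
        rw [hA i (Finset.mem_insert_of_mem hi), hA i (Finset.mem_insert_of_mem hi) r]
        have : (r ∪ t) ∩ D i = r ∩ D i := by
          ext a
          have h1 := @ht a
          have h2 : a ∈ D i → a ∉ D j := fun ha =>
            Finset.disjoint_left.1 (hdisj i (Finset.mem_insert_of_mem hi) j
              (Finset.mem_insert_self j I) (fun h => hj (h ▸ hi))) ha
          simp only [Finset.mem_union, Finset.mem_inter] at h1 ⊢
          tauto
        rw [this]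
      have h3 : (∀ i ∈ insert j I, ¬ A i (r ∪ t)) ↔ (∀ i ∈ I, ¬ A i r) ∧ ¬ A j t := by
        simp only [Finset.mem_insert, forall_eq_or_imp, h1]
        constructor
        · rintro ⟨h, h'⟩
          exact ⟨fun i hi => (h2 i hi).not.1 (h' i hi), h⟩
        · rintro ⟨h, h'⟩
          exact ⟨h', fun i hi => (h2 i hi).not.2 (h i hi)⟩
      by_cases h4 : ∀ i ∈ I, ¬ A i r <;> by_cases h5 : A j t <;> simp only [h3, h4, h5] <;> simp
    rw [hprod, Finset.card_insert_of_notMem hj, pow_succ]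
    have h0 : 0 ≤ subsetProb (D j) (fun s => ¬ A j s) := by unfold subsetProb; positivity
    have h1 : 0 ≤ 1 - q := by linarith
    gcongr

/-- Few members of a disjoint family of `d`-sets meet a uniformly random set in much more than
half of their elements. -/
lemma subsetProb_many_dense_le (E : Finset ι) (L : Finset κ) (D : κ → Finset ι) {d : ℕ}
    (hD : ∀ v ∈ L, (D v).card = d)
    (hdisj : ∀ v ∈ L, ∀ w ∈ L, v ≠ w → Disjoint (D v) (D w)) {γ : ℝ} (hγ : 0 ≤ γ) (b : ℝ) :
    subsetProb E (fun s => b < (L.filter fun v => (1 / 2 + γ) * d ≤ ((s ∩ D v).card : ℝ)).card)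
      ≤ 2 ^ L.card * Real.exp (-(2 * γ ^ 2 * d * b)) := by
  classical
  have h1 : subsetProb E
      (fun s => b < (L.filter fun v => (1 / 2 + γ) * d ≤ ((s ∩ D v).card : ℝ)).card)
      ≤ subsetProb E (fun s => ∃ T ∈ L.powerset.filter (fun T => b < T.card),
          (1 / 2 + γ) * ((d * T.card : ℕ) : ℝ) ≤ (s ∩ T.biUnion D).card) := by
    refine subsetProb_mono fun s _ hs => ?_
    refine ⟨L.filter fun v => (1 / 2 + γ) * d ≤ ((s ∩ D v).card : ℝ),
      Finset.mem_filter.2 ⟨Finset.mem_powerset.2 (Finset.filter_subset _ _), hs⟩, ?_⟩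
    set T := L.filter fun v => (1 / 2 + γ) * d ≤ ((s ∩ D v).card : ℝ) with hT
    have hTL : ∀ v ∈ T, v ∈ L := fun v hv => (Finset.mem_filter.1 hv).1
    have : (s ∩ T.biUnion D).card = ∑ v ∈ T, (s ∩ D v).card := by
      rw [Finset.inter_biUnion, Finset.card_biUnion]
      intro v hv w hw hvw
      exact (hdisj v (hTL v hv) w (hTL w hw) hvw).mono Finset.inter_subset_right
        Finset.inter_subset_right
    rw [this]
    push_cast
    calc (1 / 2 + γ) * (d * T.card : ℝ) = ∑ v ∈ T, (1 / 2 + γ) * (d : ℝ) := by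
          simp; ring
      _ ≤ _ := Finset.sum_le_sum fun v hv => (Finset.mem_filter.1 hv).2
  refine h1.trans ((subsetProb_exists_le _ _ _).trans ?_)
  have h2 : ∀ T ∈ L.powerset.filter (fun T => b < (T.card : ℝ)),
      subsetProb E (fun s => (1 / 2 + γ) * ((d * T.card : ℕ) : ℝ) ≤ (s ∩ T.biUnion D).card)
        ≤ Real.exp (-(2 * γ ^ 2 * d * b)) := by
    intro T hT
    rw [Finset.mem_filter, Finset.mem_powerset] at hT
    refine (subsetProb_card_inter_le E (T.biUnion D) ?_ hγ).trans ?_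
    · refine Finset.card_biUnion_le.trans ?_
      rw [Finset.sum_congr rfl (fun v hv => hD v (hT.1 hv))]
      simp [mul_comm]
    · apply Real.exp_le_exp.2
      push_cast
      have : 2 * γ ^ 2 * d * b ≤ 2 * γ ^ 2 * d * T.card := by
        gcongr
        exact hT.2.le
      linarith
  refine (Finset.sum_le_sum h2).trans ?_
  rw [Finset.sum_const, nsmul_eq_mul]
  gcongr
  calc (((L.powerset.filter (fun T => b < (T.card : ℝ))).card : ℕ) : ℝ)
      ≤ (L.powerset.card : ℕ) := by exact_mod_cast Finset.card_filter_le _ _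
    _ = _ := by simp

end UniformSubset

section Transfer

variable {V W : Type} [Fintype V] [Fintype W]

lemma subgraphProb_half (G : SimpleGraph V) (A : SimpleGraph V → Prop) :
    subgraphProb G (1 / 2) A =
      subsetProb G.edgeSet.toFinset (fun s => A (SimpleGraph.fromEdgeSet ↑s)) := by
  unfold subgraphProb subsetProb
  rw [Finset.sum_div]
  refine Finset.sum_congr rfl fun s hs => ?_
  have hc := Finset.card_le_card (Finset.mem_powerset.1 hs)
  split_ifs
  · rw [show (1 - 1 / 2 : ℝ) = 1 / 2 by norm_num, ← pow_add, Nat.add_sub_cancel' hc, div_pow,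
      one_pow]
  · simp

lemma coloringNumber_map (e : V ≃ W) (H : SimpleGraph V) :
    coloringNumber (H.map e.toEmbedding) = coloringNumber H := by
  unfold coloringNumber
  congr 1
  ext t
  have hcard : ∀ (S : Finset V) (v : V),
      ((S.map e.toEmbedding).filter (fun u => (H.map e.toEmbedding).Adj (e.toEmbedding v) u)).card =
        (S.filter (fun u => H.Adj v u)).card := by
    intro S v
    rw [Finset.filter_map, Finset.card_map]
    congr 1
    ext u
    have := SimpleGraph.map_adj_apply (G := H) (f := e.toEmbedding) (a := v) (b := u)
    simp only [Equiv.coe_toEmbedding] at this ⊢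
    simp [this]
  simp only [Set.mem_ofPred_eq]
  constructor
  · intro h S hS
    obtain ⟨w, hw, hlt⟩ := h (S.map e.toEmbedding) hS.map
    obtain ⟨v, hv, rfl⟩ := Finset.mem_map.1 hw
    refine ⟨v, hv, (hcard S v).symm.trans_lt ?_⟩
    convert hlt
  · intro h S hS
    obtain ⟨v, hv, hlt⟩ := h (S.map e.symm.toEmbedding) (hS.map)
    have hS' : (S.map e.symm.toEmbedding).map e.toEmbedding = S := by
      ext x; simp
    refine ⟨e.toEmbedding v, ?_, ?_⟩
    · simpa using hv
    · rw [← hcard, hS'] at hlt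
      convert hlt

lemma subgraphProb_map (e : V ≃ W) (G : SimpleGraph V) (p : ℝ) (A : SimpleGraph W → Prop) :
    subgraphProb (G.map e.toEmbedding) p A =
      subgraphProb G p (fun H => A (H.map e.toEmbedding)) := by
  unfold subgraphProb
  have hE : ∀ inst : Fintype (G.map e.toEmbedding).edgeSet,
      @Set.toFinset _ (G.map e.toEmbedding).edgeSet inst =
        G.edgeSet.toFinset.map e.toEmbedding.sym2Map := by
    intro inst
    ext x
    rw [Set.mem_toFinset, SimpleGraph.edgeSet_map]
    simp
  rw [hE]
  symm
  refine Finset.sum_bij (fun s _ => s.map e.toEmbedding.sym2Map) ?_ ?_ ?_ ?_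
  · intro s hs
    rw [Finset.mem_powerset] at hs ⊢
    exact Finset.map_subset_map.2 hs
  · intro s _ t _ h
    exact Finset.map_injective _ h
  · intro t ht
    rw [Finset.mem_powerset, Finset.subset_map_iff] at ht
    obtain ⟨s, hs, rfl⟩ := ht
    exact ⟨s, Finset.mem_powerset.2 hs, rfl⟩
  · intro s hs
    have : SimpleGraph.fromEdgeSet (V := W) ↑(s.map e.toEmbedding.sym2Map) =
        (SimpleGraph.fromEdgeSet (V := V) ↑s).map e.toEmbedding := by
      ext x y
      obtain ⟨x, rfl⟩ := e.surjective x
      obtain ⟨y, rfl⟩ := e.surjective y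
      have h1 := SimpleGraph.map_adj_apply (G := SimpleGraph.fromEdgeSet (V := V) ↑s)
        (f := e.toEmbedding) (a := x) (b := y)
      have h2 : s(e x, e y) ∈ s.map e.toEmbedding.sym2Map ↔ s(x, y) ∈ s :=
        Finset.mem_map' (a := s(x, y)) e.toEmbedding.sym2Map
      simp only [Equiv.coe_toEmbedding] at h1 ⊢
      rw [h1]
      simp only [SimpleGraph.fromEdgeSet_adj, Finset.mem_coe, h2, ne_eq,
        EmbeddingLike.apply_eq_iff_eq]
    simp only [this, Finset.card_map]

/-- A regular graph on any finite type can be moved to some `Fin n`. -/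
lemma exists_fin_regular_graph [Nonempty V] (G : SimpleGraph V) {k : ℕ}
    (hG : G.IsRegularOfDegree k) (p x : ℝ) :
    ∃ (n : ℕ) (G' : SimpleGraph (Fin n)), 0 < n ∧ G'.IsRegularOfDegree k ∧
      subgraphProb G' p (fun H => (coloringNumber H : ℝ) ≤ x) =
        subgraphProb G p (fun H => (coloringNumber H : ℝ) ≤ x) := by
  let e := Fintype.equivFin V
  refine ⟨Fintype.card V, G.map e.toEmbedding, Fintype.card_pos, ?_, ?_⟩
  · intro w
    obtain ⟨v, rfl⟩ := e.surjective w
    rw [← hG v]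
    convert SimpleGraph.Iso.degree_eq (SimpleGraph.Iso.map e G) v
    · rfl
    · rfl
  · rw [subgraphProb_map]
    simp only [coloringNumber_map]

lemma coloringNumber_le {H : SimpleGraph V} {t : ℕ}
    (h : ∀ S : Finset V, S.Nonempty → ∃ v ∈ S, (S.filter (fun u => H.Adj v u)).card < t) :
    coloringNumber H ≤ t :=
  Nat.sInf_le h

end Transfer

/-- Vertices of the graph: in each of the `M` layers there is a lower and an upper copy of the
plane over `ZMod p`, each point of which is replaced by `m` vertices. -/
@[ext]
structure LayerVertex (M p m : ℕ) where
  layer : ZMod M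
  upper : Bool
  x : ZMod p
  y : ZMod p
  u : ZMod m

namespace LayerVertex

variable {M p m : ℕ}

/-- Vertices as tuples of their coordinates. -/
def equivProd : LayerVertex M p m ≃ ZMod M × Bool × ZMod p × ZMod p × ZMod m where
  toFun v := (v.layer, v.upper, v.x, v.y, v.u)
  invFun t := ⟨t.1, t.2.1, t.2.2.1, t.2.2.2.1, t.2.2.2.2⟩
  left_inv _ := rfl
  right_inv _ := rfl

noncomputable instance [NeZero M] [NeZero p] [NeZero m] : Fintype (LayerVertex M p m) :=
  Fintype.ofEquiv _ equivProd.symm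

/-- The oriented relation joining cyclically consecutive lines `x = const` in a lower plane, and
incident point-line pairs in the upper planes of consecutive layers. -/
def Forward (v w : LayerVertex M p m) : Prop :=
  (v.upper = true ∧ w.upper = true ∧ w.layer = v.layer + 1 ∧ v.y + w.y = v.x * w.x) ∨
    (v.upper = false ∧ w.upper = false ∧ w.layer = v.layer ∧ w.x = v.x + 1)

/-- The relation joining the lower and the upper copy of a line `x = const` of a layer. -/
def Rung (v w : LayerVertex M p m) : Prop :=
  w.upper = !v.upper ∧ w.layer = v.layer ∧ w.x = v.x

/-- A sparse relation, from lower to upper planes, that adjusts the degree. -/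
def Skew (r : ℕ) (v w : LayerVertex M p m) : Prop :=
  v.upper = false ∧ w.upper = true ∧ w.layer = v.layer ∧ w.x = v.x + 1 ∧ w.y = v.y ∧
    (w.u - v.u).val < r

/-- The three main kinds of neighbours. -/
def Nbr (δ : Fin 3) (v w : LayerVertex M p m) : Prop :=
  match δ with
  | 0 => Forward v w
  | 1 => Forward w v
  | 2 => Rung v w

lemma Rung.symm {v w : LayerVertex M p m} (h : Rung v w) : Rung w v := by
  obtain ⟨h1, h2, h3⟩ := h
  exact ⟨by simp [h1], h2.symm, h3.symm⟩

lemma add_one_ne {n : ℕ} (hn : 2 ≤ n) (a : ZMod n) : a + 1 ≠ a := by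
  intro h
  have : Fact (1 < n) := ⟨hn⟩
  simp at h

lemma add_one_add_one_ne {n : ℕ} (hn : 3 ≤ n) (a : ZMod n) : a + 1 + 1 ≠ a := by
  intro h
  have h1 : ((2 : ℕ) : ZMod n) = 0 := by
    push_cast
    linear_combination h
  rw [ZMod.natCast_eq_zero_iff] at h1
  exact absurd (Nat.le_of_dvd (by norm_num) h1) (by omega)

lemma Forward.not_symm (hM : 3 ≤ M) (hp : 3 ≤ p) {v w : LayerVertex M p m}
    (h : Forward v w) : ¬ Forward w v := by
  rintro h'
  rcases h with ⟨h1, h2, h3, -⟩ | ⟨h1, h2, -, h3⟩ <;>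
    rcases h' with ⟨h4, h5, h6, -⟩ | ⟨h4, h5, -, h6⟩
  · rw [h3] at h6
    exact add_one_add_one_ne hM _ h6.symm
  · simp_all
  · simp_all
  · rw [h3] at h6
    exact add_one_add_one_ne hp _ h6.symm

lemma Forward.upper_eq {v w : LayerVertex M p m} (h : Forward v w) : w.upper = v.upper := by
  rcases h with ⟨h1, h2, -⟩ | ⟨h1, h2, -⟩ <;> rw [h1, h2]

lemma Forward.ne (hM : 3 ≤ M) (hp : 3 ≤ p) {v w : LayerVertex M p m} (h : Forward v w) :
    v ≠ w := by
  rintro rfl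
  exact h.not_symm hM hp h

lemma Rung.upper_ne {v w : LayerVertex M p m} (h : Rung v w) : w.upper ≠ v.upper := by
  rw [h.1]; cases v.upper <;> simp

/-- The regular graph of degree `3 * (p * m) + r`. -/
def layerGraph (M p m r : ℕ) : SimpleGraph (LayerVertex M p m) where
  Adj v w := (∃ δ, Nbr δ v w) ∧ v ≠ w ∨ (Skew r v w ∨ Skew r w v)
  symm := ⟨by
    rintro v w (⟨⟨δ, h⟩, hne⟩ | h)
    · refine Or.inl ⟨?_, hne.symm⟩
      match δ, h with
      | 0, h => exact ⟨1, h⟩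
      | 1, h => exact ⟨0, h⟩
      | 2, h => exact ⟨2, Rung.symm h⟩
    · exact Or.inr h.symm⟩
  loopless := ⟨by
    rintro v (⟨-, h⟩ | ⟨h, h', -⟩ | ⟨h, h', -⟩)
    · exact h rfl
    · simp_all
    · simp_all⟩

lemma Nbr.ne (hM : 3 ≤ M) (hp : 3 ≤ p) {δ : Fin 3} {v w : LayerVertex M p m} (h : Nbr δ v w) :
    v ≠ w := by
  match δ, h with
  | 0, h => exact Forward.ne hM hp h
  | 1, h => exact (Forward.ne hM hp h).symm
  | 2, h => rintro rfl; exact Rung.upper_ne h rfl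

lemma Nbr.eq_of_nbr (hM : 3 ≤ M) (hp : 3 ≤ p) {δ δ' : Fin 3} {v w : LayerVertex M p m}
    (h : Nbr δ v w) (h' : Nbr δ' v w) : δ = δ' := by
  match δ, δ', h, h' with
  | 0, 0, _, _ | 1, 1, _, _ | 2, 2, _, _ => rfl
  | 0, 1, h, h' => exact absurd h' (Forward.not_symm hM hp h)
  | 1, 0, h, h' => exact absurd h (Forward.not_symm hM hp h')
  | 0, 2, h, h' => exact absurd (Forward.upper_eq h) (Rung.upper_ne h')
  | 1, 2, h, h' => exact absurd (Forward.upper_eq h).symm (Rung.upper_ne h')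
  | 2, 0, h, h' => exact absurd (Forward.upper_eq h') (Rung.upper_ne h)
  | 2, 1, h, h' => exact absurd (Forward.upper_eq h').symm (Rung.upper_ne h)

lemma Nbr.not_skew (hp : 3 ≤ p) {r : ℕ} {δ : Fin 3} {v w : LayerVertex M p m}
    (h : Nbr δ v w) : ¬ (Skew r v w ∨ Skew r w v) := by
  have key : ∀ {v w : LayerVertex M p m}, Skew r v w → ¬ Rung v w := by
    rintro v w ⟨-, -, -, h1, -⟩ ⟨-, -, h2⟩
    exact add_one_ne (by omega) _ (h1.symm.trans h2)
  have key' : ∀ {v w : LayerVertex M p m}, Skew r v w → w.upper ≠ v.upper := by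
    rintro v w ⟨h1, h2, -⟩
    simp [h1, h2]
  rintro (hs | hs) <;> match δ, h with
  | 0, h => first | exact key' hs (Forward.upper_eq h) | exact key' hs (Forward.upper_eq h).symm
  | 1, h => first | exact key' hs (Forward.upper_eq h) | exact key' hs (Forward.upper_eq h).symm
  | 2, h => first | exact key hs h | exact key hs (Rung.symm h)

section Card

variable [NeZero M] [NeZero p] [NeZero m]

lemma card_nbr (δ : Fin 3) (v : LayerVertex M p m) :
    (Finset.univ.filter fun w => Nbr δ v w).card = p * m := by
  have hcard : (Finset.univ : Finset (ZMod p × ZMod m)).card = p * m := by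
    simp [ZMod.card]
  rw [← hcard]
  obtain ⟨i, b, x, y, u⟩ := v
  match δ, b with
  | 0, true =>
    refine Finset.card_nbij' (fun w => (w.x, w.u)) (fun t => ⟨i + 1, true, t.1, x * t.1 - y, t.2⟩)
      ?_ ?_ ?_ ?_
    · simp [Set.MapsTo]
    · simp [Set.MapsTo, Nbr, Forward]
    · rintro ⟨i', b', x', y', u'⟩ hw
      simp [Nbr, Forward] at hw
      obtain ⟨rfl, rfl, h⟩ := hw
      simp [← h]
    · simp [Set.RightInvOn, Set.LeftInvOn]
  | 1, true =>
    refine Finset.card_nbij' (fun w => (w.x, w.u)) (fun t => ⟨i - 1, true, t.1, x * t.1 - y, t.2⟩)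
      ?_ ?_ ?_ ?_
    · simp [Set.MapsTo]
    · simp [Set.MapsTo, Nbr, Forward, mul_comm]
    · rintro ⟨i', b', x', y', u'⟩ hw
      simp [Nbr, Forward] at hw
      obtain ⟨rfl, rfl, h⟩ := hw
      simp [mul_comm x, ← h]
    · simp [Set.RightInvOn, Set.LeftInvOn]
  | 2, true =>
    refine Finset.card_nbij' (fun w => (w.y, w.u)) (fun t => ⟨i, false, x, t.1, t.2⟩) ?_ ?_ ?_ ?_
    · simp [Set.MapsTo]
    · simp [Set.MapsTo, Nbr, Rung]
    · rintro ⟨i', b', x', y', u'⟩ hw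
      simp [Nbr, Rung] at hw
      obtain ⟨rfl, rfl, rfl⟩ := hw
      rfl
    · simp [Set.RightInvOn, Set.LeftInvOn]
  | 0, false =>
    refine Finset.card_nbij' (fun w => (w.y, w.u)) (fun t => ⟨i, false, x + 1, t.1, t.2⟩)
      ?_ ?_ ?_ ?_
    · simp [Set.MapsTo]
    · simp [Set.MapsTo, Nbr, Forward]
    · rintro ⟨i', b', x', y', u'⟩ hw
      simp [Nbr, Forward] at hw
      obtain ⟨rfl, rfl, rfl⟩ := hw
      rfl
    · simp [Set.RightInvOn, Set.LeftInvOn]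
  | 1, false =>
    refine Finset.card_nbij' (fun w => (w.y, w.u)) (fun t => ⟨i, false, x - 1, t.1, t.2⟩)
      ?_ ?_ ?_ ?_
    · simp [Set.MapsTo]
    · simp [Set.MapsTo, Nbr, Forward]
    · rintro ⟨i', b', x', y', u'⟩ hw
      simp [Nbr, Forward] at hw
      obtain ⟨rfl, rfl, rfl⟩ := hw
      simp
    · simp [Set.RightInvOn, Set.LeftInvOn]
  | 2, false =>
    refine Finset.card_nbij' (fun w => (w.y, w.u)) (fun t => ⟨i, true, x, t.1, t.2⟩) ?_ ?_ ?_ ?_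
    · simp [Set.MapsTo]
    · simp [Set.MapsTo, Nbr, Rung]
    · rintro ⟨i', b', x', y', u'⟩ hw
      simp [Nbr, Rung] at hw
      obtain ⟨rfl, rfl, rfl⟩ := hw
      rfl
    · simp [Set.RightInvOn, Set.LeftInvOn]

lemma card_skew {r : ℕ} (hr : r ≤ m) (v : LayerVertex M p m) :
    (Finset.univ.filter fun w => Skew r v w ∨ Skew r w v).card = r := by
  have hval : ∀ {a : ℕ}, a < r → (a : ZMod m).val = a := fun h =>
    ZMod.val_cast_of_lt (h.trans_le hr)
  conv_rhs => rw [← Finset.card_range r]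
  obtain ⟨i, b, x, y, u⟩ := v
  cases b with
  | false =>
    refine Finset.card_nbij' (fun w => (w.u - u).val) (fun a => ⟨i, true, x + 1, y, u + a⟩)
      ?_ ?_ ?_ ?_
    · intro w hw
      simp [Skew] at hw
      simp [hw]
    · intro a ha
      simp at ha
      simp [Skew, hval ha, ha]
    · rintro ⟨i', b', x', y', u'⟩ hw
      simp [Skew] at hw
      obtain ⟨rfl, rfl, rfl, rfl, h⟩ := hw
      simp
    · intro a ha
      simp at ha
      simp [hval ha]
  | true =>
    refine Finset.card_nbij' (fun w => (u - w.u).val) (fun a => ⟨i, false, x - 1, y, u - a⟩)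
      ?_ ?_ ?_ ?_
    · intro w hw
      simp [Skew] at hw
      simp [hw]
    · intro a ha
      simp at ha
      simp [Skew, hval ha, ha]
    · rintro ⟨i', b', x', y', u'⟩ hw
      simp [Skew] at hw
      obtain ⟨rfl, rfl, rfl, rfl, h⟩ := hw
      simp
    · intro a ha
      simp at ha
      simp [hval ha]

lemma layerGraph_isRegularOfDegree (hM : 3 ≤ M) (hp : 3 ≤ p) {r : ℕ} (hr : r ≤ m) :
    (layerGraph M p m r).IsRegularOfDegree (3 * (p * m) + r) := by
  intro v
  have h : (layerGraph M p m r).neighborFinset v =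
      (Finset.univ : Finset (Fin 3)).biUnion (fun δ => Finset.univ.filter fun w => Nbr δ v w) ∪
        Finset.univ.filter fun w => Skew r v w ∨ Skew r w v := by
    ext w
    rw [SimpleGraph.mem_neighborFinset]
    simp only [layerGraph, Finset.mem_union, Finset.mem_biUnion,
      Finset.mem_filter, Finset.mem_univ, true_and]
    refine or_congr_left (and_iff_left_of_imp ?_)
    rintro ⟨δ, h⟩
    exact h.ne hM hp
  rw [← SimpleGraph.card_neighborFinset_eq_degree, h, Finset.card_union_of_disjoint,
    Finset.card_biUnion, card_skew hr]
  · simp [card_nbr]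
  · intro δ _ δ' _ hne
    rw [Function.onFun, Finset.disjoint_left]
    intro w hw hw'
    exact hne ((Finset.mem_filter.1 hw).2.eq_of_nbr hM hp (Finset.mem_filter.1 hw').2)
  · rw [Finset.disjoint_left]
    intro w hw hw'
    obtain ⟨δ, -, h⟩ := Finset.mem_biUnion.1 hw
    exact (Finset.mem_filter.1 h).2.not_skew hp (Finset.mem_filter.1 hw').2

end Card

end LayerVertex

namespace LayerVertex

variable {M p m : ℕ}

lemma mk_injective (v : LayerVertex M p m) : Function.Injective fun w => s(v, w) :=
  fun _ _ h => Sym2.congr_right.1 h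

/-- The number of main neighbours of `v` of kind `δ` in `S`, along the edges in `s`. -/
noncomputable def degIn (S : Finset (LayerVertex M p m)) (s : Finset (Sym2 (LayerVertex M p m)))
    (δ : Fin 3) (v : LayerVertex M p m) : ℕ :=
  (S.filter fun w => Nbr δ v w ∧ s(v, w) ∈ s).card

variable {S : Finset (LayerVertex M p m)} {s : Finset (Sym2 (LayerVertex M p m))}

lemma degIn_eq_zero {δ : Fin 3} {v : LayerVertex M p m}
    (h : ∀ w ∈ S, Nbr δ v w → s(v, w) ∉ s) : degIn S s δ v = 0 := by
  rw [degIn, Finset.card_eq_zero, Finset.filter_eq_empty_iff]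
  exact fun w hw hn => h w hw hn.1 hn.2

/-- Incidence of points and lines. -/
def Inc (v w : LayerVertex M p m) : Prop := v.y + w.y = v.x * w.x

variable [NeZero M] [NeZero p] [NeZero m]

/-- The pairs joining `v` to its main neighbours of kind `δ`. -/
noncomputable def spokes (δ : Fin 3) (v : LayerVertex M p m) : Finset (Sym2 (LayerVertex M p m)) :=
  (Finset.univ.filter fun w => Nbr δ v w).image fun w => s(v, w)

lemma card_spokes (δ : Fin 3) (v : LayerVertex M p m) : (spokes δ v).card = p * m := by
  rw [spokes, Finset.card_image_of_injective _ (mk_injective v), card_nbr]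

lemma degIn_le_card (δ : Fin 3) (v : LayerVertex M p m) : degIn S s δ v ≤ p * m := by
  rw [← card_nbr δ v]
  refine Finset.card_le_card fun w hw => ?_
  simp only [Finset.mem_filter, Finset.mem_univ, true_and] at hw ⊢
  exact hw.2.1

lemma degIn_le_inter_spokes (δ : Fin 3) (v : LayerVertex M p m) :
    degIn S s δ v ≤ (s ∩ spokes δ v).card := by
  rw [degIn, ← Finset.card_image_of_injective _ (mk_injective v)]
  refine Finset.card_le_card fun e he => ?_
  obtain ⟨w, hw, rfl⟩ := Finset.mem_image.1 he
  rw [Finset.mem_filter] at hw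
  exact Finset.mem_inter.2 ⟨hw.2.2, Finset.mem_image.2
    ⟨w, Finset.mem_filter.2 ⟨Finset.mem_univ _, hw.2.1⟩, rfl⟩⟩

lemma card_adj_le {r : ℕ} (hr : r ≤ m) (hs : s ⊆ (layerGraph M p m r).edgeSet.toFinset)
    (v : LayerVertex M p m) :
    (S.filter fun w => (SimpleGraph.fromEdgeSet (V := LayerVertex M p m) ↑s).Adj v w).card ≤
      degIn S s 0 v + degIn S s 1 v + degIn S s 2 v + r := by
  have hsub : (S.filter fun w => (SimpleGraph.fromEdgeSet (V := LayerVertex M p m) ↑s).Adj v w) ⊆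
      (Finset.univ : Finset (Fin 3)).biUnion (fun δ => S.filter fun w => Nbr δ v w ∧ s(v, w) ∈ s) ∪
        Finset.univ.filter fun w => Skew r v w ∨ Skew r w v := by
    intro w hw
    rw [Finset.mem_filter, SimpleGraph.fromEdgeSet_adj] at hw
    have hadj : (layerGraph M p m r).Adj v w := by
      have := hs hw.2.1
      rwa [Set.mem_toFinset, SimpleGraph.mem_edgeSet] at this
    rcases hadj with ⟨⟨δ, h⟩, -⟩ | h
    · exact Finset.mem_union_left _ (Finset.mem_biUnion.2 ⟨δ, Finset.mem_univ _,
        Finset.mem_filter.2 ⟨hw.1, h, hw.2.1⟩⟩)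
    · exact Finset.mem_union_right _ (Finset.mem_filter.2 ⟨Finset.mem_univ _, h⟩)
  refine (Finset.card_le_card hsub).trans ((Finset.card_union_le _ _).trans ?_)
  rw [card_skew hr]
  refine Nat.add_le_add_right (Finset.card_biUnion_le.trans ?_) r
  rw [Fin.sum_univ_three]
  rfl

omit [NeZero M] in
lemma card_inc_le (i : ZMod M) (T : Finset (LayerVertex M p m))
    (hT : ∀ v ∈ T, v.upper = true ∧ v.layer = i) (z : LayerVertex M p m) :
    (T.filter fun v => Inc v z).card ≤ p * m := by
  have hcard : (Finset.univ : Finset (ZMod p × ZMod m)).card = p * m := by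
    simp [ZMod.card]
  rw [← hcard]
  refine Finset.card_le_card_of_injOn (fun v => (v.x, v.u)) (fun _ _ => by simp) ?_
  intro v hv w hw h
  rw [Finset.mem_coe, Finset.mem_filter] at hv hw
  obtain ⟨h1, h2⟩ := Prod.mk.inj h
  have h3 : v.y = w.y := by
    have hv' : v.y + z.y = v.x * z.x := hv.2
    have hw' : w.y + z.y = w.x * z.x := hw.2
    rw [show v.x = w.x from h1] at hv'
    linear_combination hv' - hw'
  exact LayerVertex.ext ((hT v hv.1).2.trans (hT w hw.1).2.symm)
    ((hT v hv.1).1.trans (hT w hw.1).1.symm) h1 h3 h2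

omit [NeZero M] [NeZero p] in
lemma card_inc_inc_le [Fact p.Prime] (i : ZMod M) (T : Finset (LayerVertex M p m))
    (hT : ∀ v ∈ T, v.upper = true ∧ v.layer = i) {z z' : LayerVertex M p m}
    (hne : ¬ (z.x = z'.x ∧ z.y = z'.y)) :
    (T.filter fun v => Inc v z ∧ Inc v z').card ≤ m := by
  have hcard : (Finset.univ : Finset (ZMod m)).card = m := by simp [ZMod.card]
  conv_rhs => rw [← hcard]
  refine Finset.card_le_card_of_injOn (fun v => v.u) (fun _ _ => by simp) ?_
  intro v hv w hw h
  rw [Finset.mem_coe, Finset.mem_filter] at hv hw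
  obtain ⟨hvT, hv1, hv2⟩ := hv
  obtain ⟨hwT, hw1, hw2⟩ := hw
  simp only [Inc] at hv1 hv2 hw1 hw2
  have hx : v.x = w.x := by
    have h1 : (v.x - w.x) * (z.x - z'.x) = 0 := by linear_combination -hv1 + hv2 + hw1 - hw2
    rcases mul_eq_zero.1 h1 with h1 | h1
    · exact sub_eq_zero.1 h1
    · exfalso
      have h2 := sub_eq_zero.1 h1
      refine hne ⟨h2, ?_⟩
      rw [h2] at hv1
      linear_combination hv1 - hv2
  have hy : v.y = w.y := by
    rw [hx] at hv1
    linear_combination hv1 - hw1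
  exact LayerVertex.ext ((hT v hvT).2.trans (hT w hwT).2.symm)
    ((hT v hvT).1.trans (hT w hwT).1.symm) hx hy h

omit [NeZero M] in
/-- Few vertices of an upper plane have many neighbours in a given subset of another one. -/
lemma card_mul_sq_le [Fact p.Prime] (i j : ZMod M) (T X : Finset (LayerVertex M p m))
    (hT : ∀ v ∈ T, v.upper = true ∧ v.layer = i) (hX : ∀ v ∈ X, v.upper = true ∧ v.layer = j)
    {c : ℝ} (hc : 0 ≤ c) (h : ∀ v ∈ T, c ≤ ((X.filter fun w => Inc v w).card : ℝ)) :
    T.card * c ^ 2 ≤ (X.card : ℝ) * (m * (p * m) + X.card * m) := by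
  have h1 : T.card * c ^ 2 ≤ ∑ v ∈ T, ((X.filter fun w => Inc v w).card : ℝ) ^ 2 := by
    rw [← nsmul_eq_mul, ← Finset.sum_const]
    refine Finset.sum_le_sum fun v hv => ?_
    have := h v hv
    gcongr
  refine h1.trans ?_
  have h2 : ∑ v ∈ T, (X.filter fun w => Inc v w).card ^ 2 =
      ∑ z ∈ X, ∑ z' ∈ X, (T.filter fun v => Inc v z ∧ Inc v z').card := by
    simp_rw [Finset.card_filter, sq, Finset.sum_mul_sum]
    rw [Finset.sum_comm]
    refine Finset.sum_congr rfl fun z _ => ?_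
    rw [Finset.sum_comm]
    refine Finset.sum_congr rfl fun z' _ => Finset.sum_congr rfl fun v _ => ?_
    by_cases h1 : Inc v z <;> by_cases h2 : Inc v z' <;> simp [h1, h2]
  have h3 : ∀ z ∈ X, ∑ z' ∈ X, (T.filter fun v => Inc v z ∧ Inc v z').card
      ≤ m * (p * m) + X.card * m := by
    intro z _
    rw [← Finset.sum_filter_add_sum_filter_not X (fun z' => z.x = z'.x ∧ z.y = z'.y)]
    refine Nat.add_le_add ?_ ?_
    · calc _ ≤ ∑ z' ∈ X.filter (fun z' => z.x = z'.x ∧ z.y = z'.y), p * m := by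
            refine Finset.sum_le_sum fun z' _ => ?_
            refine le_trans (Finset.card_le_card ?_) (card_inc_le i T hT z)
            intro v hv
            rw [Finset.mem_filter] at hv ⊢
            exact ⟨hv.1, hv.2.1⟩
        _ ≤ m * (p * m) := by
            rw [Finset.sum_const, smul_eq_mul]
            refine Nat.mul_le_mul_right _ ?_
            have hcard : (Finset.univ : Finset (ZMod m)).card = m := by simp [ZMod.card]
            conv_rhs => rw [← hcard]
            refine Finset.card_le_card_of_injOn (fun v => v.u) (fun _ _ => by simp) ?_
            intro v hv w hw h
            simp only [Finset.coe_filter, Set.mem_ofPred_eq] at hv hw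
            exact LayerVertex.ext ((hX v hv.1).2.trans (hX w hw.1).2.symm)
              ((hX v hv.1).1.trans (hX w hw.1).1.symm) (hv.2.1.symm.trans hw.2.1)
              (hv.2.2.symm.trans hw.2.2) h
    · calc _ ≤ ∑ z' ∈ X.filter (fun z' => ¬ (z.x = z'.x ∧ z.y = z'.y)), m :=
            Finset.sum_le_sum fun z' hz' => card_inc_inc_le i T hT (Finset.mem_filter.1 hz').2
        _ ≤ X.card * m := by
            rw [Finset.sum_const, smul_eq_mul]
            exact Nat.mul_le_mul_right _ (Finset.card_filter_le _ _)
  have h4 := Finset.sum_le_sum h3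
  rw [← h2, Finset.sum_const, smul_eq_mul] at h4
  exact_mod_cast h4

omit [NeZero M] in
lemma card_le_quarter [Fact p.Prime] {γ : ℝ} (hγ : 0 < γ) (hp : 8 ≤ p * γ ^ 2)
    (i j : ZMod M) (T X : Finset (LayerVertex M p m))
    (hT : ∀ v ∈ T, v.upper = true ∧ v.layer = i) (hX : ∀ v ∈ X, v.upper = true ∧ v.layer = j)
    (hcard : (X.card : ℝ) ≤ γ ^ 2 / 8 * (p * (p * m)))
    (h : ∀ v ∈ T, γ * (p * m) ≤ ((X.filter fun w => Inc v w).card : ℝ)) :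
    (T.card : ℝ) ≤ X.card / 4 := by
  have hp0 : (0 : ℝ) < p := by exact_mod_cast Nat.pos_of_ne_zero (NeZero.ne p)
  have hm0 : (0 : ℝ) < m := by exact_mod_cast Nat.pos_of_ne_zero (NeZero.ne m)
  have h1 := card_mul_sq_le i j T X hT hX (by positivity) h
  have h2 : (m * (p * m) + X.card * m : ℝ) ≤ (γ * (p * m)) ^ 2 / 4 := by
    have h3 : (X.card : ℝ) * m ≤ γ ^ 2 / 8 * (p * (p * m)) * m := by gcongr
    have h4 : (8 : ℝ) * (p * m * m) ≤ p * γ ^ 2 * (p * m * m) := by gcongr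
    nlinarith
  have h3 : (T.card : ℝ) * (γ * (p * m)) ^ 2 ≤ X.card / 4 * (γ * (p * m)) ^ 2 := by
    refine h1.trans ?_
    have : (X.card : ℝ) * (m * (p * m) + X.card * m) ≤ X.card * ((γ * (p * m)) ^ 2 / 4) := by gcongr
    linarith
  exact le_of_mul_le_mul_right h3 (by positivity)

end LayerVertex

namespace LayerVertex

variable {M p m : ℕ} {S : Finset (LayerVertex M p m)} {s : Finset (Sym2 (LayerVertex M p m))}

/-- A cyclic sequence of lower lines dies out once one of the lines is missing. -/
lemma lower_ne_of_chain (i : ZMod M) (x₀ : ZMod p) [NeZero p]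
    (h0 : ∀ v ∈ S, v.upper = false → v.layer = i → v.x ≠ x₀)
    (hstep : ∀ v ∈ S, v.upper = false → v.layer = i → degIn S s 1 v ≠ 0) :
    ∀ v ∈ S, v.upper = false → v.layer ≠ i := by
  have key : ∀ n : ℕ, ∀ v ∈ S, v.upper = false → v.layer = i → v.x ≠ x₀ + n := by
    intro n
    induction n with
    | zero => simpa using h0
    | succ n ih =>
      intro v hv hb hi hx
      refine hstep v hv hb hi (degIn_eq_zero fun w hw hvw _ => ?_)
      rcases hvw with ⟨-, h, -⟩ | ⟨hw1, -, hw2, hw3⟩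
      · simp [hb] at h
      · refine ih w hw hw1 (hw2.symm.trans hi) ?_
        rw [hx] at hw3
        push_cast at hw3
        linear_combination -hw3
  intro v hv hb hi
  refine key (v.x - x₀).val v hv hb hi ?_
  rw [ZMod.natCast_zmod_val]
  ring

lemma degIn_le_inc {δ : Fin 3} {v : LayerVertex M p m} (hv : v.upper = true) {j : ZMod M}
    (hj : δ = 0 ∧ j = v.layer + 1 ∨ δ = 1 ∧ v.layer = j + 1) :
    degIn S s δ v ≤
      ((S.filter fun w => w.upper = true ∧ w.layer = j).filter fun w => Inc v w).card := by
  refine Finset.card_le_card fun w hw => ?_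
  simp only [Finset.mem_filter] at hw ⊢
  obtain ⟨hw, hn, -⟩ := hw
  rcases hj with ⟨rfl, rfl⟩ | ⟨rfl, hj⟩
  · rcases hn with ⟨-, h1, h2, h3⟩ | ⟨h1, -⟩
    · exact ⟨⟨hw, h1, h2⟩, h3⟩
    · simp [hv] at h1
  · rcases hn with ⟨h1, -, h2, h3⟩ | ⟨-, h1, -⟩
    · refine ⟨⟨hw, h1, add_right_cancel (h2.symm.trans hj)⟩, ?_⟩
      rw [Inc, add_comm, h3, mul_comm]
    · simp [hv] at h1

variable [NeZero M] [NeZero p] [NeZero m]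

/-- A vertex is heavy if many of its edges of some kind are present. -/
def Heavy (γ : ℝ) (s : Finset (Sym2 (LayerVertex M p m))) (v : LayerVertex M p m) : Prop :=
  ∃ δ, (1 / 2 + γ) * (p * m) ≤ ((s ∩ spokes δ v).card : ℝ)

lemma degIn_lt_of_not_heavy {γ : ℝ} {v : LayerVertex M p m} (hv : ¬ Heavy γ s v) (δ : Fin 3) :
    (degIn S s δ v : ℝ) < (1 / 2 + γ) * (p * m) := by
  refine lt_of_le_of_lt ?_ (not_le.1 fun h => hv ⟨δ, h⟩)
  exact_mod_cast degIn_le_inter_spokes δ v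

section Deterministic

variable {γ : ℝ} (hγ : 0 < γ) (hγ_half : γ ≤ 1 / 2) (hp : 8 ≤ p * γ ^ 2)
  (hbig : ∀ v ∈ S, (1 + 3 * γ) * (p * m) <
    (degIn S s 0 v + degIn S s 1 v + degIn S s 2 v : ℝ))
  (hfew : ∀ i b, ((Finset.univ.filter fun v : LayerVertex M p m =>
    v.layer = i ∧ v.upper = b ∧ Heavy γ s v).card : ℝ) ≤ γ ^ 2 / 16 * (p * (p * m)))

include hγ hbig

/-- The lower part of a nucleus is disjoint from a dense subgraph. -/
lemma lower_ne_of_nucleus {i : ZMod M}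
    (hnuc : ∀ v w : LayerVertex M p m, v.layer = i → v.upper = false → v.x = 0 → s(v, w) ∉ s)
    (hgood : ∀ v : LayerVertex M p m, v.layer = i → v.upper = false → ¬ Heavy γ s v) :
    ∀ v ∈ S, v.upper = false → v.layer ≠ i := by
  have hd : (0 : ℝ) ≤ p * m := by positivity
  refine lower_ne_of_chain (s := s) i 0 ?_ ?_
  · intro v hv hb hi hx
    have h0 : ∀ δ, degIn S s δ v = 0 := fun δ =>
      degIn_eq_zero fun w _ _ => hnuc v w hi hb hx
    have := hbig v hv
    rw [h0, h0, h0] at this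
    push_cast at this
    nlinarith
  · intro v hv hb hi h1
    have := hbig v hv
    have h0 := degIn_lt_of_not_heavy (S := S) (hgood v hi hb) 0
    have h2 := degIn_lt_of_not_heavy (S := S) (hgood v hi hb) 2
    rw [h1] at this
    push_cast at this
    nlinarith

include hγ_half hfew

/-- A dense subgraph contains an upper vertex. -/
lemma exists_upper (hS : S.Nonempty) : ∃ v ∈ S, v.upper = true := by
  have hp0 : (0 : ℝ) < p := by exact_mod_cast Nat.pos_of_ne_zero (NeZero.ne p)
  have hd : (0 : ℝ) ≤ p * m := by positivity
  by_contra hcon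
  have hlow : ∀ v ∈ S, v.upper = false := fun v hv => by
    simpa using fun h => hcon ⟨v, hv, h⟩
  have h2 : ∀ v ∈ S, degIn S s 2 v = 0 := fun v hv => degIn_eq_zero fun w hw hn _ =>
    Rung.upper_ne hn ((hlow w hw).trans (hlow v hv).symm)
  obtain ⟨v₀, hv₀⟩ := hS
  set i := v₀.layer
  set H := Finset.univ.filter fun v : LayerVertex M p m =>
    v.layer = i ∧ v.upper = false ∧ Heavy γ s v with hH
  obtain ⟨x₀, -, hx₀⟩ : ∃ x₀ ∈ (Finset.univ : Finset (ZMod p)),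
      ((H.filter fun v => v.x = x₀).card : ℝ) ≤ γ * (p * m) := by
    refine Finset.exists_le_of_sum_le Finset.univ_nonempty ?_
    rw [← Nat.cast_sum, ← Finset.card_eq_sum_card_fiberwise (fun _ _ => by simp), Finset.sum_const,
      Finset.card_univ, ZMod.card, nsmul_eq_mul]
    refine (hfew i false).trans ?_
    have : γ ^ 2 / 16 ≤ γ := by nlinarith
    calc _ ≤ γ * (p * (p * m) : ℝ) := by gcongr
      _ = _ := by ring
  have hheavy : ∀ v ∈ S, v.layer = i → v.x = x₀ → v ∈ H.filter fun v => v.x = x₀ := by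
    intro v hv hi hx
    rw [Finset.mem_filter, hH, Finset.mem_filter]
    refine ⟨⟨Finset.mem_univ _, hi, hlow v hv, ?_⟩, hx⟩
    by_contra hl
    have := hbig v hv
    have h0 := degIn_lt_of_not_heavy (S := S) hl 0
    have h1 := degIn_lt_of_not_heavy (S := S) hl 1
    rw [h2 v hv] at this
    push_cast at this
    nlinarith
  have hsum : ∀ v ∈ S, γ * (p * m) < (degIn S s 1 v : ℝ) := by
    intro v hv
    have := hbig v hv
    have h0 : (degIn S s 0 v : ℝ) ≤ p * m := by exact_mod_cast degIn_le_card 0 v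
    rw [h2 v hv] at this
    push_cast at this
    nlinarith
  refine lower_ne_of_chain (s := s) i (x₀ + 1) ?_ ?_ v₀ hv₀ (hlow v₀ hv₀) rfl
  · intro v hv hb hi hx
    have h1 : degIn S s 1 v ≤ (H.filter fun v => v.x = x₀).card := by
      refine Finset.card_le_card fun w hw => ?_
      obtain ⟨hw, hn, -⟩ := Finset.mem_filter.1 hw
      rcases hn with ⟨-, h, -⟩ | ⟨-, -, h3, h4⟩
      · simp [hb] at h
      · exact hheavy w hw (h3.symm.trans hi) (add_right_cancel (h4.symm.trans hx))
    have := hsum v hv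
    have h1' : (degIn S s 1 v : ℝ) ≤ (H.filter fun v => v.x = x₀).card := by exact_mod_cast h1
    linarith
  · intro v hv _ _ h1
    have := hsum v hv
    rw [h1] at this
    push_cast at this
    nlinarith

include hp

omit hγ_half in
/-- In the presence of a nucleus, a dense subgraph contains no upper vertex. -/
lemma upper_eq_false_of_nucleus [Fact p.Prime] {i₀ : ZMod M}
    (hnuc : ∀ v ∈ S, v.upper = false → v.layer ≠ i₀) : ∀ v ∈ S, v.upper = false := by
  have hd : (0 : ℝ) ≤ p * m := by positivity
  set X : ZMod M → Finset (LayerVertex M p m) := fun i =>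
    S.filter fun v => v.upper = true ∧ v.layer = i with hX
  have hX' : ∀ i, ∀ v ∈ X i, v.upper = true ∧ v.layer = i := fun i v hv =>
    (Finset.mem_filter.1 hv).2
  have hXS : ∀ i, ∀ v ∈ X i, v ∈ S := fun i v hv => (Finset.mem_filter.1 hv).1
  have hH : ∀ i, (((X i).filter fun v => Heavy γ s v).card : ℝ) ≤ γ ^ 2 / 16 * (p * (p * m)) := by
    intro i
    refine le_trans ?_ (hfew i true)
    gcongr
    intro v hv
    rw [Finset.mem_filter] at hv
    exact Finset.mem_filter.2 ⟨Finset.mem_univ _, (hX' i v hv.1).2, (hX' i v hv.1).1, hv.2⟩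
  have hquarter : ∀ i j (δ : Fin 3), δ = 0 ∧ j = i + 1 ∨ δ = 1 ∧ i = j + 1 →
      ((X j).card : ℝ) ≤ γ ^ 2 / 8 * (p * (p * m)) →
      (((X i).filter fun v => γ * (p * m) ≤ (degIn S s δ v : ℝ)).card : ℝ) ≤ (X j).card / 4 := by
    intro i j δ hj hXj
    refine card_le_quarter hγ hp i j _ _ (fun v hv => hX' i v (Finset.mem_filter.1 hv).1)
      (hX' j) hXj fun v hv => ?_
    rw [Finset.mem_filter] at hv
    have h1 := hX' i v hv.1
    refine hv.2.trans ?_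
    exact_mod_cast degIn_le_inc h1.1 (by rw [h1.2]; exact hj)
  have hstart : ((X i₀).card : ℝ) ≤ γ ^ 2 / 8 * (p * (p * m)) := by
    have : X i₀ = (X i₀).filter fun v => Heavy γ s v := by
      refine (Finset.filter_true_of_mem fun v hv => ?_).symm
      by_contra hl
      have h := hbig v (hXS _ v hv)
      have h0 := degIn_lt_of_not_heavy (S := S) hl 0
      have h1 := degIn_lt_of_not_heavy (S := S) hl 1
      have h2 : degIn S s 2 v = 0 := degIn_eq_zero fun w hw hn _ => by
        refine hnuc w hw ?_ (hn.2.1.trans (hX' _ v hv).2)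
        rw [hn.1, (hX' _ v hv).1]; rfl
      rw [h2] at h
      push_cast at h
      nlinarith
    rw [this]
    refine (hH i₀).trans ?_
    gcongr
    norm_num
  have hsucc : ∀ i, ((X i).card : ℝ) ≤ γ ^ 2 / 8 * (p * (p * m)) →
      ((X (i + 1)).card : ℝ) ≤ γ ^ 2 / 8 * (p * (p * m)) := by
    intro i hi
    have h1 := hquarter (i + 1) i 1 (Or.inr ⟨rfl, rfl⟩) hi
    have h2 : X (i + 1) ⊆ (X (i + 1)).filter (fun v => Heavy γ s v) ∪
        (X (i + 1)).filter fun v => γ * (p * m) ≤ (degIn S s 1 v : ℝ) := by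
      intro v hv
      rw [Finset.mem_union]
      by_contra hcon
      have hl : ¬ Heavy γ s v := fun h => hcon (Or.inl (Finset.mem_filter.2 ⟨hv, h⟩))
      have hl' := not_le.1 fun h => hcon (Or.inr (Finset.mem_filter.2 ⟨hv, h⟩))
      have h := hbig v (hXS _ v hv)
      have h0 := degIn_lt_of_not_heavy (S := S) hl 0
      have h2 := degIn_lt_of_not_heavy (S := S) hl 2
      nlinarith
    have h3 : ((X (i + 1)).card : ℝ) ≤ ((X (i + 1)).filter (fun v => Heavy γ s v)).card +
        ((X (i + 1)).filter fun v => γ * (p * m) ≤ (degIn S s 1 v : ℝ)).card := by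
      exact_mod_cast (Finset.card_le_card h2).trans (Finset.card_union_le _ _)
    have h4 := hH (i + 1)
    have : (0 : ℝ) ≤ γ ^ 2 / 8 * (p * (p * m)) := by positivity
    linarith
  have hall : ∀ i, ((X i).card : ℝ) ≤ γ ^ 2 / 8 * (p * (p * m)) := by
    have key : ∀ n : ℕ, ((X (i₀ + n)).card : ℝ) ≤ γ ^ 2 / 8 * (p * (p * m)) := by
      intro n
      induction n with
      | zero => simpa using hstart
      | succ n ih =>
        have := hsucc _ ih
        rwa [add_assoc, ← Nat.cast_succ] at this
    intro i
    have := key (i - i₀).val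
    rwa [ZMod.natCast_zmod_val, add_sub_cancel] at this
  obtain ⟨i, hi⟩ := Finite.exists_max fun i => (X i).card
  have h0 := hquarter i (i + 1) 0 (Or.inl ⟨rfl, rfl⟩) (hall _)
  have h1 := hquarter i (i - 1) 1 (Or.inr ⟨rfl, by ring⟩) (hall _)
  have h2 : X i ⊆ (X i).filter (fun v => γ * (p * m) ≤ (degIn S s 0 v : ℝ)) ∪
      (X i).filter fun v => γ * (p * m) ≤ (degIn S s 1 v : ℝ) := by
    intro v hv
    rw [Finset.mem_union]
    by_contra hcon
    have hl := not_le.1 fun h => hcon (Or.inl (Finset.mem_filter.2 ⟨hv, h⟩))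
    have hl' := not_le.1 fun h => hcon (Or.inr (Finset.mem_filter.2 ⟨hv, h⟩))
    have h := hbig v (hXS _ v hv)
    have h2 : (degIn S s 2 v : ℝ) ≤ p * m := by exact_mod_cast degIn_le_card 2 v
    nlinarith
  have h3 : ((X i).card : ℝ) ≤ ((X i).filter fun v => γ * (p * m) ≤ (degIn S s 0 v : ℝ)).card +
      ((X i).filter fun v => γ * (p * m) ≤ (degIn S s 1 v : ℝ)).card := by
    exact_mod_cast (Finset.card_le_card h2).trans (Finset.card_union_le _ _)
  have h4 : ((X (i + 1)).card : ℝ) ≤ (X i).card := by exact_mod_cast hi _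
  have h5 : ((X (i - 1)).card : ℝ) ≤ (X i).card := by exact_mod_cast hi _
  have h6 : (X i).card = 0 := by
    have : ((X i).card : ℝ) ≤ 0 := by linarith
    exact_mod_cast this.antisymm (Nat.cast_nonneg _)
  intro v hv
  by_contra hb
  have h7 : (X v.layer).card = 0 := Nat.le_zero.1 ((hi v.layer).trans h6.le)
  rw [Finset.card_eq_zero, Finset.eq_empty_iff_forall_notMem] at h7
  exact h7 v (Finset.mem_filter.2 ⟨hv, by simpa using hb, rfl⟩)

end Deterministic

/-- A subgraph of the layer graph containing a nucleus and with few heavy vertices is sparse. -/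
lemma exists_card_adj_le [Fact p.Prime] {r : ℕ} {γ : ℝ} (hγ : 0 < γ) (hγ_half : γ ≤ 1 / 2)
    (hp : 8 ≤ p * γ ^ 2) (hr : r ≤ m) (hr' : r ≤ γ * (p * m))
    (hs : s ⊆ (layerGraph M p m r).edgeSet.toFinset)
    (hfew : ∀ i b, ((Finset.univ.filter fun v : LayerVertex M p m =>
      v.layer = i ∧ v.upper = b ∧ Heavy γ s v).card : ℝ) ≤ γ ^ 2 / 16 * (p * (p * m)))
    {i₀ : ZMod M}
    (hnuc : ∀ v w : LayerVertex M p m, v.layer = i₀ → v.upper = false → v.x = 0 → s(v, w) ∉ s)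
    (hgood : ∀ v : LayerVertex M p m, v.layer = i₀ → v.upper = false → ¬ Heavy γ s v)
    (hS : S.Nonempty) :
    ∃ v ∈ S, ((S.filter fun w => (SimpleGraph.fromEdgeSet (V := LayerVertex M p m) ↑s).Adj v w).card
      : ℝ) ≤ (1 + 4 * γ) * (p * m) := by
  by_contra! hcon
  have hbig : ∀ v ∈ S, (1 + 3 * γ) * (p * m) <
      (degIn S s 0 v + degIn S s 1 v + degIn S s 2 v : ℝ) := by
    intro v hv
    have h1 := hcon v hv
    have h2 : ((S.filter fun w =>
        (SimpleGraph.fromEdgeSet (V := LayerVertex M p m) ↑s).Adj v w).card : ℝ) ≤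
        degIn S s 0 v + degIn S s 1 v + degIn S s 2 v + r := by
      exact_mod_cast card_adj_le hr hs v
    linarith
  obtain ⟨v, hv, hb⟩ := exists_upper hγ hγ_half hbig hfew hS
  have := upper_eq_false_of_nucleus hγ hp hbig hfew
    (lower_ne_of_nucleus hγ hbig hnuc hgood) v hv
  simp [hb] at this

end LayerVertex

lemma subsetProb_sdiff_le {ι : Type} {D F : Finset ι} (h : F ⊆ D) (A : Finset ι → Prop) :
    subsetProb (D \ F) A / 2 ^ F.card ≤ subsetProb D A := by
  have hc : (2 : ℝ) ^ D.card = 2 ^ (D \ F).card * 2 ^ F.card := by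
    rw [← pow_add, Finset.card_sdiff_add_card_eq_card h]
  rw [subsetProb, subsetProb, div_div, ← hc, sum_powerset_split h]
  gcongr with r hr
  have h1 := Finset.single_le_sum (s := F.powerset)
    (f := fun t => if A (r ∪ t) then (1 : ℝ) else 0) (fun t _ => by positivity)
    (Finset.empty_mem_powerset F)
  simpa using h1

namespace LayerVertex

variable {M p m : ℕ} [NeZero M] [NeZero p] [NeZero m]

lemma card_layer_le (i : ZMod M) (b : Bool) :
    (Finset.univ.filter fun v : LayerVertex M p m => v.layer = i ∧ v.upper = b).card ≤
      p * (p * m) := by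
  have hcard : (Finset.univ : Finset (ZMod p × ZMod p × ZMod m)).card = p * (p * m) := by
    simp [ZMod.card]
  rw [← hcard]
  refine Finset.card_le_card_of_injOn (fun v => (v.x, v.y, v.u)) (fun _ _ => by simp) ?_
  intro v hv w hw h
  rw [Finset.mem_coe, Finset.mem_filter] at hv hw
  simp only [Prod.mk.injEq] at h
  exact LayerVertex.ext (hv.2.1.trans hw.2.1.symm) (hv.2.2.trans hw.2.2.symm) h.1 h.2.1 h.2.2

lemma card_line_le (i : ZMod M) (b : Bool) (x₀ : ZMod p) :
    (Finset.univ.filter fun v : LayerVertex M p m =>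
      v.layer = i ∧ v.upper = b ∧ v.x = x₀).card ≤ p * m := by
  have hcard : (Finset.univ : Finset (ZMod p × ZMod m)).card = p * m := by
    simp [ZMod.card]
  rw [← hcard]
  refine Finset.card_le_card_of_injOn (fun v => (v.y, v.u)) (fun _ _ => by simp) ?_
  intro v hv w hw h
  rw [Finset.mem_coe, Finset.mem_filter] at hv hw
  simp only [Prod.mk.injEq] at h
  exact LayerVertex.ext (hv.2.1.trans hw.2.1.symm) (hv.2.2.1.trans hw.2.2.1.symm)
    (hv.2.2.2.trans hw.2.2.2.symm) h.1 h.2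

lemma disjoint_spokes (hM : 3 ≤ M) (hp : 3 ≤ p) (δ : Fin 3) {v w : LayerVertex M p m}
    (hb : v.upper = w.upper) (hne : v ≠ w) : Disjoint (spokes δ v) (spokes δ w) := by
  rw [Finset.disjoint_left]
  intro e he he'
  obtain ⟨a, ha, rfl⟩ := Finset.mem_image.1 he
  obtain ⟨c, hc, h⟩ := Finset.mem_image.1 he'
  rw [Finset.mem_filter] at ha hc
  rw [Sym2.eq_iff] at h
  rcases h with ⟨h, -⟩ | ⟨rfl, rfl⟩
  · exact hne h.symm
  · match δ, ha.2, hc.2 with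
    | 0, h1, h2 => exact Forward.not_symm hM hp h1 h2
    | 1, h1, h2 => exact Forward.not_symm hM hp h1 h2
    | 2, h1, _ => exact Rung.upper_ne h1 hb.symm

/-- It is unlikely that some plane contains many heavy vertices. -/
lemma subsetProb_many_heavy_le (hM : 3 ≤ M) (hp : 3 ≤ p) (E : Finset (Sym2 (LayerVertex M p m)))
    {γ : ℝ} (hγ : 0 ≤ γ) {b : ℝ} :
    subsetProb E (fun s => ∃ i c, 3 * b < ((Finset.univ.filter fun v : LayerVertex M p m =>
      v.layer = i ∧ v.upper = c ∧ Heavy γ s v).card : ℝ)) ≤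
    6 * M * (2 ^ (p * (p * m)) * Real.exp (-(2 * γ ^ 2 * (p * m) * b))) := by
  set L : ZMod M × Bool → Finset (LayerVertex M p m) := fun a =>
    Finset.univ.filter fun v => v.layer = a.1 ∧ v.upper = a.2 with hL
  set B : ZMod M × Bool × Fin 3 → Finset (Sym2 (LayerVertex M p m)) → Prop := fun a s =>
    b < (((L (a.1, a.2.1)).filter fun v =>
      (1 / 2 + γ) * ((p * m : ℕ) : ℝ) ≤ ((s ∩ spokes a.2.2 v).card : ℝ)).card : ℝ) with hB
  have h1 : ∀ a, subsetProb E (B a) ≤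
      2 ^ (p * (p * m)) * Real.exp (-(2 * γ ^ 2 * (p * m) * b)) := by
    intro a
    refine (subsetProb_many_dense_le E (L (a.1, a.2.1)) (spokes a.2.2) (d := p * m)
      (fun v _ => card_spokes _ v) ?_ hγ b).trans ?_
    · intro v hv w hw hne
      refine disjoint_spokes hM hp _ ?_ hne
      rw [hL, Finset.mem_filter] at hv hw
      exact hv.2.2.trans hw.2.2.symm
    · push_cast
      gcongr
      · norm_num
      · exact card_layer_le _ _
  have h2 : subsetProb E (fun s => ∃ i c, 3 * b < ((Finset.univ.filter
      fun v : LayerVertex M p m => v.layer = i ∧ v.upper = c ∧ Heavy γ s v).card : ℝ)) ≤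
      subsetProb E (fun s => ∃ a ∈ Finset.univ, B a s) := by
    refine subsetProb_mono fun s _ => ?_
    rintro ⟨i, c, h⟩
    by_contra! hcon
    have h3 : (Finset.univ.filter
        fun v : LayerVertex M p m => v.layer = i ∧ v.upper = c ∧ Heavy γ s v) ⊆
        (Finset.univ : Finset (Fin 3)).biUnion fun δ => (L (i, c)).filter fun v =>
          (1 / 2 + γ) * ((p * m : ℕ) : ℝ) ≤ ((s ∩ spokes δ v).card : ℝ) := by
      intro v hv
      obtain ⟨-, hi, hc, δ, hδ⟩ := Finset.mem_filter.1 hv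
      refine Finset.mem_biUnion.2 ⟨δ, Finset.mem_univ _, Finset.mem_filter.2
        ⟨Finset.mem_filter.2 ⟨Finset.mem_univ _, hi, hc⟩, ?_⟩⟩
      push_cast
      exact hδ
    have h4 : ((Finset.univ.filter fun v : LayerVertex M p m =>
        v.layer = i ∧ v.upper = c ∧ Heavy γ s v).card : ℝ) ≤ ∑ δ : Fin 3,
        (((L (i, c)).filter fun v =>
          (1 / 2 + γ) * ((p * m : ℕ) : ℝ) ≤ ((s ∩ spokes δ v).card : ℝ)).card : ℝ) := by
      exact_mod_cast (Finset.card_le_card h3).trans Finset.card_biUnion_le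
    have h5 : ∀ δ : Fin 3, (((L (i, c)).filter fun v =>
        (1 / 2 + γ) * ((p * m : ℕ) : ℝ) ≤ ((s ∩ spokes δ v).card : ℝ)).card : ℝ) ≤ b :=
      fun δ => not_lt.1 (hcon (i, c, δ) (Finset.mem_univ _))
    have h6 := Finset.sum_le_sum fun δ (_ : δ ∈ (Finset.univ : Finset (Fin 3))) => h5 δ
    rw [Finset.sum_const, Finset.card_univ, Fintype.card_fin, nsmul_eq_mul] at h6
    push_cast at h6 h4
    linarith
  refine h2.trans ((subsetProb_exists_le _ _ _).trans ?_)
  refine (Finset.sum_le_sum fun a _ => h1 a).trans_eq ?_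
  rw [Finset.sum_const, nsmul_eq_mul]
  congr 1
  simp [ZMod.card]
  ring

/-- The lower plane of layer `i` contains an isolated line and no heavy vertices. -/
def Nucleus (γ : ℝ) (s : Finset (Sym2 (LayerVertex M p m))) (i : ZMod M) : Prop :=
  (∀ v w : LayerVertex M p m, v.layer = i → v.upper = false → v.x = 0 → s(v, w) ∉ s) ∧
    ∀ v : LayerVertex M p m, v.layer = i → v.upper = false → ¬ Heavy γ s v

/-- The edges meeting the lower plane of layer `i`. -/
noncomputable def lowerEdges (r : ℕ) (i : ZMod M) : Finset (Sym2 (LayerVertex M p m)) :=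
  (layerGraph M p m r).edgeSet.toFinset.filter fun e => ∃ v ∈ e, v.layer = i ∧ v.upper = false

lemma disjoint_lowerEdges (r : ℕ) {i j : ZMod M} (hij : i ≠ j) :
    Disjoint (lowerEdges (p := p) (m := m) r i) (lowerEdges r j) := by
  rw [Finset.disjoint_left]
  intro e he he'
  obtain ⟨he, v, hv, hvi, hvb⟩ := Finset.mem_filter.1 he
  obtain ⟨-, w, hw, hwi, hwb⟩ := Finset.mem_filter.1 he'
  have hne : v ≠ w := by
    rintro rfl
    exact hij (hvi.symm.trans hwi)
  have h : e = s(v, w) := (Sym2.mem_and_mem_iff hne).1 ⟨hv, hw⟩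
  rw [h, Set.mem_toFinset, SimpleGraph.mem_edgeSet] at he
  refine hij (hvi.symm.trans (Eq.trans ?_ hwi))
  rcases he with ⟨⟨δ, h⟩, -⟩ | ⟨-, h, -⟩ | ⟨-, h, -⟩
  · match δ, h with
    | 0, h =>
      rcases h with ⟨h, -⟩ | ⟨-, -, h, -⟩
      · simp [hvb] at h
      · exact h.symm
    | 1, h =>
      rcases h with ⟨h, -⟩ | ⟨-, -, h, -⟩
      · simp [hwb] at h
      · exact h
    | 2, h => exact absurd (hwb.trans hvb.symm) (Rung.upper_ne h)
  · simp [hwb] at h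
  · simp [hvb] at h

lemma Nucleus.of_inter {r : ℕ} {γ : ℝ} {i : ZMod M} {s : Finset (Sym2 (LayerVertex M p m))}
    (hs : s ⊆ (layerGraph M p m r).edgeSet.toFinset) (h : Nucleus γ (s ∩ lowerEdges r i) i) :
    Nucleus γ s i := by
  refine ⟨fun v w hi hb hx hvw => h.1 v w hi hb hx (Finset.mem_inter.2 ⟨hvw,
    Finset.mem_filter.2 ⟨hs hvw, v, Sym2.mem_mk_left _ _, hi, hb⟩⟩), fun v hi hb => ?_⟩
  rintro ⟨δ, hδ⟩
  refine h.2 v hi hb ⟨δ, hδ.trans ?_⟩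
  gcongr ((Finset.card ?_ : ℕ) : ℝ)
  intro e he
  obtain ⟨he, he'⟩ := Finset.mem_inter.1 he
  refine Finset.mem_inter.2 ⟨Finset.mem_inter.2 ⟨he, Finset.mem_filter.2 ⟨hs he, v, ?_, hi, hb⟩⟩,
    he'⟩
  obtain ⟨w, -, rfl⟩ := Finset.mem_image.1 he'
  exact Sym2.mem_mk_left _ _

lemma le_subsetProb_nucleus (hM : 3 ≤ M) (hp : 3 ≤ p) {r : ℕ} (hr : r ≤ m) {γ : ℝ} (hγ : 0 ≤ γ)
    (hsmall : 3 * (p * (p * m)) * Real.exp (-(2 * γ ^ 2 * (p * m))) ≤ 1 / 2) (i : ZMod M) :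
    1 / 2 / 2 ^ (4 * (p * m) ^ 2) ≤
      subsetProb (lowerEdges (p := p) (m := m) r i)
        (fun s => Nucleus γ (s ∩ lowerEdges r i) i) := by
  set D := lowerEdges (p := p) (m := m) r i with hD
  set F := D.filter fun e => ∃ v ∈ e, v.layer = i ∧ v.upper = false ∧ v.x = 0 with hF
  set C := Finset.univ.filter fun v : LayerVertex M p m => v.layer = i ∧ v.upper = false ∧ v.x = 0
    with hC
  have hFcard : F.card ≤ 4 * (p * m) ^ 2 := by
    have h1 : F ⊆ C.biUnion fun v => ((layerGraph M p m r).neighborFinset v).image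
        fun w => s(v, w) := by
      intro e he
      obtain ⟨he, v, hv, hvC⟩ := Finset.mem_filter.1 he
      obtain ⟨w, rfl⟩ := hv
      have he := (Finset.mem_filter.1 he).1
      rw [Set.mem_toFinset, SimpleGraph.mem_edgeSet] at he
      exact Finset.mem_biUnion.2 ⟨v, Finset.mem_filter.2 ⟨Finset.mem_univ _, hvC⟩,
        Finset.mem_image.2 ⟨w, (SimpleGraph.mem_neighborFinset _ _ _).2 he, rfl⟩⟩
    have h2 : C.card ≤ p * m := card_line_le i false 0
    have h3 : r ≤ p * m := hr.trans (Nat.le_mul_of_pos_left m (by omega))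
    calc F.card ≤ ∑ v ∈ C, (3 * (p * m) + r) := by
          refine (Finset.card_le_card h1).trans (Finset.card_biUnion_le.trans ?_)
          refine Finset.sum_le_sum fun v _ => Finset.card_image_le.trans_eq ?_
          rw [SimpleGraph.card_neighborFinset_eq_degree]
          exact layerGraph_isRegularOfDegree hM hp hr v
      _ ≤ (p * m) * (4 * (p * m)) := by
          rw [Finset.sum_const, smul_eq_mul]
          exact Nat.mul_le_mul h2 (by omega)
      _ = 4 * (p * m) ^ 2 := by ring
  have hsplit : subsetProb (D \ F) (fun s => Nucleus γ (s ∩ D) i) / 2 ^ F.card ≤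
      subsetProb D (fun s => Nucleus γ (s ∩ D) i) := by
    convert subsetProb_sdiff_le (Finset.filter_subset _ _ : F ⊆ D) _
  refine le_trans ?_ hsplit
  have hhalf : 1 / 2 ≤ subsetProb (D \ F) (fun s => Nucleus γ (s ∩ D) i) := by
    set T := (Finset.univ.filter fun v : LayerVertex M p m => v.layer = i ∧ v.upper = false) ×ˢ
      (Finset.univ : Finset (Fin 3)) with hT
    have h1 : subsetProb (D \ F) (fun s => ¬ Nucleus γ (s ∩ D) i) ≤
        subsetProb (D \ F) (fun s => ∃ a ∈ T,
          (1 / 2 + γ) * ((p * m : ℕ) : ℝ) ≤ ((s ∩ spokes a.2 a.1).card : ℝ)) := by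
      refine subsetProb_mono fun s hs h => ?_
      by_contra! hcon
      refine h ⟨fun v w hi hb hx hvw => ?_, fun v hi hb => ?_⟩
      · obtain ⟨h2, h3⟩ := Finset.mem_inter.1 hvw
        exact (Finset.mem_sdiff.1 (hs h2)).2 (Finset.mem_filter.2
          ⟨h3, v, Sym2.mem_mk_left _ _, hi, hb, hx⟩)
      · rintro ⟨δ, hδ⟩
        have h2 := hcon (v, δ) (Finset.mem_product.2
          ⟨Finset.mem_filter.2 ⟨Finset.mem_univ _, hi, hb⟩, Finset.mem_univ _⟩)
        rw [Finset.inter_eq_left.2 (hs.trans Finset.sdiff_subset)] at hδ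
        push_cast at h2
        exact absurd hδ (not_le.2 h2)
    have h2 := h1.trans (subsetProb_exists_le _ _ _)
    have h3 : ∑ a ∈ T, subsetProb (D \ F) (fun s =>
        (1 / 2 + γ) * ((p * m : ℕ) : ℝ) ≤ ((s ∩ spokes a.2 a.1).card : ℝ)) ≤ 1 / 2 := by
      refine (Finset.sum_le_sum fun a _ =>
        subsetProb_card_inter_le (D \ F) (spokes a.2 a.1) (card_spokes _ _).le hγ).trans ?_
      rw [Finset.sum_const, nsmul_eq_mul]
      refine le_trans ?_ hsmall
      push_cast
      gcongr
      have : T.card ≤ 3 * (p * (p * m)) := by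
        rw [hT, Finset.card_product, Finset.card_univ, Fintype.card_fin, mul_comm]
        exact Nat.mul_le_mul_left 3 (card_layer_le i false)
      exact_mod_cast this
    have h4 := subsetProb_add_not (D \ F) (fun s => Nucleus γ (s ∩ D) i)
    linarith
  exact div_le_div₀ (by linarith) hhalf (by positivity)
    (pow_le_pow_right₀ (by norm_num) hFcard)

/-- It is unlikely that there is no nucleus. -/
lemma subsetProb_no_nucleus_le (hM : 3 ≤ M) (hp : 3 ≤ p) {r : ℕ} (hr : r ≤ m) {γ : ℝ} (hγ : 0 ≤ γ)
    (hsmall : 3 * (p * (p * m)) * Real.exp (-(2 * γ ^ 2 * (p * m))) ≤ 1 / 2) :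
    subsetProb (layerGraph M p m r).edgeSet.toFinset (fun s => ∀ i, ¬ Nucleus γ s i) ≤
      (1 - 1 / 2 / 2 ^ (4 * (p * m) ^ 2)) ^ M := by
  have hq : (1 / 2 / 2 ^ (4 * (p * m) ^ 2) : ℝ) ≤ 1 := by
    rw [div_le_one (by positivity)]
    exact le_trans (by norm_num) (one_le_pow₀ (by norm_num : (1 : ℝ) ≤ 2))
  have h := subsetProb_forall_not_le (Finset.univ : Finset (ZMod M))
    (lowerEdges (p := p) (m := m) r) (fun i s => Nucleus γ (s ∩ lowerEdges r i) i) _ hq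
    (fun i _ j _ hij => disjoint_lowerEdges r hij)
    (fun i _ s => by rw [Finset.inter_assoc, Finset.inter_self])
    (fun i _ => le_subsetProb_nucleus hM hp hr hγ hsmall i)
    (layerGraph M p m r).edgeSet.toFinset (fun i _ => Finset.filter_subset _ _)
  rw [Finset.card_univ, ZMod.card] at h
  refine le_trans (subsetProb_mono fun s hs hn i _ hi => hn i (hi.of_inter hs)) h

end LayerVertex

namespace LayerVertex

lemma le_subgraphProb_layerGraph {M p m r : ℕ} [NeZero M] [NeZero m] [Fact p.Prime]
    (hM : 3 ≤ M) (hp : 3 ≤ p) (hr : r ≤ m) {γ ε x : ℝ} (hγ : 0 < γ) (hγ_half : γ ≤ 1 / 2)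
    (hpγ : 8 ≤ p * γ ^ 2) (hr' : r ≤ γ * (p * m))
    (hsmall : 3 * (p * (p * m)) * Real.exp (-(2 * γ ^ 2 * (p * m))) ≤ 1 / 2)
    (hheavy : 6 * M * (2 ^ (p * (p * m)) *
      Real.exp (-(2 * γ ^ 2 * (p * m) * (γ ^ 2 / 48 * (p * (p * m)))))) ≤ ε / 2)
    (hnuc : (1 - 1 / 2 / 2 ^ (4 * (p * m) ^ 2) : ℝ) ^ M ≤ ε / 2)
    (hx : (1 + 4 * γ) * (p * m) + 1 ≤ x) :
    1 - ε ≤ subgraphProb (layerGraph M p m r) (1 / 2) fun H => (coloringNumber H : ℝ) ≤ x := by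
  have hx0 : 0 ≤ x := le_trans (by positivity) hx
  rw [subgraphProb_half]
  set E := (layerGraph M p m r).edgeSet.toFinset
  have h1 := (subsetProb_many_heavy_le hM hp E hγ.le (b := γ ^ 2 / 48 * (p * (p * m)))).trans hheavy
  have h2 := (subsetProb_no_nucleus_le hM hp hr hγ.le hsmall).trans hnuc
  have h3 := subsetProb_add_not E fun s =>
    (coloringNumber (SimpleGraph.fromEdgeSet (V := LayerVertex M p m) ↑s) : ℝ) ≤ x
  have h4 : subsetProb E (fun s => ¬
      (coloringNumber (SimpleGraph.fromEdgeSet (V := LayerVertex M p m) ↑s) : ℝ) ≤ x) ≤ _ :=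
    (subsetProb_mono fun s hs h => ?_).trans (subsetProb_or_le E
      (fun s => ∃ i c, 3 * (γ ^ 2 / 48 * (p * (p * m))) < ((Finset.univ.filter
        fun v : LayerVertex M p m => v.layer = i ∧ v.upper = c ∧ Heavy γ s v).card : ℝ))
      (fun s => ∀ i, ¬ Nucleus γ s i))
  · linarith
  · by_contra! hcon
    obtain ⟨hfew, i₀, hi₀⟩ := hcon
    refine h (le_trans ?_ (Nat.floor_le hx0))
    refine Nat.cast_le.2 (coloringNumber_le fun S hS => ?_)
    obtain ⟨v, hv, hvS⟩ := exists_card_adj_le hγ hγ_half hpγ hr hr' hs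
      (fun i b => (hfew i b).trans_eq (by ring)) hi₀.1 hi₀.2 hS
    refine ⟨v, hv, Nat.le_floor ?_⟩
    push_cast
    convert (add_le_add hvS (le_refl (1 : ℝ))).trans hx
    rfl

end LayerVertex

lemma mul_exp_neg_le_half {γ p d : ℝ} (hγ : 0 < γ) (hp : 0 < p) (hd : 3 * p / γ ^ 4 ≤ d) :
    3 * (p * d) * Real.exp (-(2 * γ ^ 2 * d)) ≤ 1 / 2 := by
  have hd0 : 0 < d := lt_of_lt_of_le (by positivity) hd
  rw [div_le_iff₀ (by positivity)] at hd
  have h1 := Real.quadratic_le_exp_of_nonneg (x := 2 * γ ^ 2 * d) (by positivity)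
  rw [Real.exp_neg, ← div_eq_mul_inv, div_le_iff₀ (Real.exp_pos _)]
  have h2 : (0 : ℝ) ≤ 2 * γ ^ 2 * d := by positivity
  have h3 : 3 * p * d ≤ d * γ ^ 4 * d := by gcongr
  nlinarith

lemma one_sub_pow_le {q ε : ℝ} {M : ℕ} (hq : q ≤ 1) (hε : 0 < ε) (h : 2 / ε ≤ q * M) :
    (1 - q) ^ M ≤ ε / 2 := by
  have h1 : (1 - q) ^ M ≤ Real.exp (-q) ^ M :=
    pow_le_pow_left₀ (by linarith) (Real.one_sub_le_exp_neg q) M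
  refine h1.trans ?_
  rw [← Real.exp_nat_mul, mul_comm, neg_mul, Real.exp_neg]
  have h2 : 2 / ε ≤ Real.exp (q * M) := h.trans (by linarith [Real.add_one_le_exp (q * M)])
  calc (Real.exp (q * M))⁻¹ ≤ (2 / ε)⁻¹ := by gcongr
    _ = ε / 2 := inv_div _ _

lemma two_pow_le_exp (n : ℕ) : (2 : ℝ) ^ n ≤ Real.exp (3 / 4 * n) := by
  have h : (2 : ℝ) ≤ Real.exp (3 / 4) := by
    rw [← Real.log_le_iff_le_exp (by norm_num)]
    linarith [Real.log_two_lt_d9]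
  calc (2 : ℝ) ^ n ≤ Real.exp (3 / 4) ^ n := by gcongr
    _ = _ := by rw [← Real.exp_nat_mul, mul_comm]

lemma layers_mul_exp_le {γ ε : ℝ} {M p d : ℕ} (hε : 0 < ε)
    (hM : M ≤ (4 / ε + 4) * 2 ^ (4 * d ^ 2)) (hp : 4 * 48 ≤ p * γ ^ 4) (hd : 48 ≤ d * γ ^ 4)
    (hdε : 12 * (4 / ε + 4) / ε ≤ d) :
    6 * M * (2 ^ (p * d) * Real.exp (-(2 * γ ^ 2 * d * (γ ^ 2 / 48 * (p * d))))) ≤ ε / 2 := by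
  have hd0 : (0 : ℝ) < d := lt_of_lt_of_le (by positivity) hdε
  have h1 : (2 : ℝ) ^ (4 * d ^ 2) * (2 ^ (p * d) *
      Real.exp (-(2 * γ ^ 2 * d * (γ ^ 2 / 48 * (p * d))))) ≤ Real.exp (-d) := by
    calc _ ≤ Real.exp (3 / 4 * (4 * d ^ 2 : ℕ)) * (Real.exp (3 / 4 * (p * d : ℕ)) *
          Real.exp (-(2 * γ ^ 2 * d * (γ ^ 2 / 48 * (p * d))))) := by
          gcongr <;> exact two_pow_le_exp _
      _ ≤ Real.exp (-d) := by
          rw [← Real.exp_add, ← Real.exp_add, Real.exp_le_exp]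
          push_cast
          have h2 : 48 * (p * d) ≤ d * γ ^ 4 * (p * d : ℝ) := by gcongr
          have h3 : 4 * 48 * (d : ℝ) ^ 2 ≤ p * γ ^ 4 * d ^ 2 := by gcongr
          have h4 : (d : ℝ) ≤ d ^ 2 := by
            have : 1 ≤ d := by exact_mod_cast hd0
            exact_mod_cast Nat.le_self_pow (by norm_num) d
          have h5 : (0 : ℝ) ≤ p * d := by positivity
          nlinarith
  have h2 : Real.exp (-d) ≤ 1 / (d : ℝ) := by
    rw [Real.exp_neg, ← one_div]
    gcongr
    linarith [Real.add_one_le_exp (d : ℝ)]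
  calc _ ≤ 6 * ((4 / ε + 4) * 2 ^ (4 * d ^ 2)) * (2 ^ (p * d) *
        Real.exp (-(2 * γ ^ 2 * d * (γ ^ 2 / 48 * (p * d))))) := by gcongr
    _ = 6 * (4 / ε + 4) * (2 ^ (4 * d ^ 2) * (2 ^ (p * d) *
        Real.exp (-(2 * γ ^ 2 * d * (γ ^ 2 / 48 * (p * d)))))) := by ring
    _ ≤ 6 * (4 / ε + 4) * (1 / d) := by
        gcongr
        exact h1.trans h2
    _ ≤ ε / 2 := by
        rw [div_le_iff₀ hε] at hdε
        rw [mul_one_div, div_le_iff₀ hd0]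
        linarith

/-- For every `α, ε > 0` and all sufficiently large `k` there is a (nonempty) `k`-regular graph
`G` with `P(𝒞(G_{1/2}) ≤ k/3 + αk) ≥ 1 - ε`; hence `𝔇(k) ≤ k/3 + o(k)`. -/
theorem coloring_number_upper_bound_third (α : ℝ) (hα : 0 < α) (ε : ℝ) (hε : 0 < ε) :
    ∃ k₀ : ℕ, ∀ k : ℕ, k₀ ≤ k →
      ∃ (n : ℕ) (G : SimpleGraph (Fin n)), 0 < n ∧ G.IsRegularOfDegree k ∧
        1 - ε ≤ subgraphProb G (1/2)
          (fun G' => (coloringNumber G' : ℝ) ≤ (k : ℝ) / 3 + α * k) := by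
  set γ := min α 1 / 2 with hγdef
  have hγ : 0 < γ := by positivity
  have hγ_half : γ ≤ 1 / 2 := by
    have := min_le_right α 1
    linarith
  have hγα : 2 * γ ≤ α := by
    have := min_le_left α 1
    linarith
  obtain ⟨N, hN⟩ := exists_nat_ge (4 * 48 / γ ^ 4)
  obtain ⟨p, hpN, hprime⟩ := Nat.exists_infinite_primes (N + 3)
  have : Fact p.Prime := ⟨hprime⟩
  have hp3 : 3 ≤ p := by omega
  have hpγ4 : 4 * 48 ≤ p * γ ^ 4 := by
    rw [← div_le_iff₀ (by positivity)]
    exact hN.trans (by exact_mod_cast (by omega : N ≤ p))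
  have hpγ2 : 8 ≤ p * γ ^ 2 := by
    have h1 : γ ^ 4 ≤ γ ^ 2 := pow_le_pow_of_le_one hγ.le (by linarith) (by norm_num)
    have h2 : p * γ ^ 4 ≤ p * γ ^ 2 := by gcongr
    linarith
  have hp0 : (0 : ℝ) < p := by exact_mod_cast hprime.pos
  have hp1 : (1 : ℝ) ≤ p := by exact_mod_cast hprime.one_le
  obtain ⟨m₀, hm₀⟩ :=
    exists_nat_ge (3 * p + 3 / γ + 48 / γ ^ 4 + 1 / α + 12 * (4 / ε + 4) / ε)
  refine ⟨3 * p * m₀, fun k hk => ?_⟩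
  set m := k / (3 * p) with hm
  set r := k % (3 * p) with hr
  have hkmr : 3 * (p * m) + r = k := by
    rw [← mul_assoc]
    exact Nat.div_add_mod k (3 * p)
  have hm₀m : m₀ ≤ m := by
    rw [hm, Nat.le_div_iff_mul_le (by omega)]
    linarith
  have hr3 : r < 3 * p := Nat.mod_lt _ (by omega)
  have hmbig : 3 * p + 3 / γ + 48 / γ ^ 4 + 1 / α + 12 * (4 / ε + 4) / ε ≤ (m : ℝ) :=
    hm₀.trans (by exact_mod_cast hm₀m)
  have hb1 : 0 < 3 / γ := by positivity
  have hb2 : 0 < 48 / γ ^ 4 := by positivity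
  have hb3 : 0 < 1 / α := by positivity
  have hb4 : 0 < 12 * (4 / ε + 4) / ε := by positivity
  have hm1 : (m : ℝ) ≤ p * m := le_mul_of_one_le_left (Nat.cast_nonneg _) hp1
  have h3pm : 3 * p ≤ m := by
    have : (3 * p : ℝ) ≤ m := by linarith
    exact_mod_cast this
  have hm0 : 0 < m := by omega
  have : NeZero m := ⟨hm0.ne'⟩
  set q : ℝ := 1 / 2 / 2 ^ (4 * (p * m) ^ 2) with hq
  set M := ⌈4 / ε * 2 ^ (4 * (p * m) ^ 2)⌉₊ + 3 with hMdef
  have : NeZero M := ⟨by omega⟩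
  have hpow : (1 : ℝ) ≤ 2 ^ (4 * (p * m) ^ 2) := one_le_pow₀ (by norm_num)
  have hsmall : 3 * (p * (p * m)) * Real.exp (-(2 * γ ^ 2 * (p * m))) ≤ 1 / 2 := by
    refine mul_exp_neg_le_half hγ hp0 ?_
    have h1 : 3 / γ ^ 4 ≤ 48 / γ ^ 4 := by gcongr; norm_num
    rw [mul_comm 3, mul_div_assoc]
    gcongr
    linarith
  have hheavy : 6 * M * (2 ^ (p * (p * m)) *
      Real.exp (-(2 * γ ^ 2 * (p * m) * (γ ^ 2 / 48 * (p * (p * m)))))) ≤ ε / 2 := by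
    have h := layers_mul_exp_le (M := M) (p := p) (d := p * m) hε ?_ hpγ4 ?_ ?_
    · push_cast at h
      exact h
    · have := (Nat.ceil_lt_add_one (by positivity : 0 ≤ 4 / ε * 2 ^ (4 * (p * m) ^ 2))).le
      rw [hMdef]
      push_cast
      linarith
    · push_cast
      rw [← div_le_iff₀ (by positivity)]
      linarith
    · push_cast
      linarith
  have hnuc : (1 - q) ^ M ≤ ε / 2 := by
    refine one_sub_pow_le ?_ hε ?_
    · rw [hq, div_le_one (by positivity)]
      linarith
    · have h1 : 4 / ε * 2 ^ (4 * (p * m) ^ 2) ≤ M := by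
        rw [hMdef]
        push_cast
        linarith [Nat.le_ceil (4 / ε * (2 : ℝ) ^ (4 * (p * m) ^ 2))]
      calc 2 / ε = q * (4 / ε * 2 ^ (4 * (p * m) ^ 2)) := by
            rw [hq]
            field_simp
            norm_num
        _ ≤ q * M := by gcongr
  have hr' : (r : ℝ) ≤ γ * (p * m) := by
    have h1 : (r : ℝ) ≤ 3 * p := by exact_mod_cast hr3.le
    have h2 : 3 ≤ m * γ := by
      rw [← div_le_iff₀ hγ]
      linarith
    nlinarith
  have hx : (1 + 4 * γ) * (p * m) + 1 ≤ (k : ℝ) / 3 + α * k := by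
    have h1 : (k : ℝ) = 3 * (p * m) + r := by exact_mod_cast hkmr.symm
    have h2 : 1 ≤ p * m * α := by
      rw [← div_le_iff₀ hα]
      linarith
    have h3 : 2 * γ * (p * m) ≤ α * (p * m) := by gcongr
    have h4 : 0 ≤ α * r := by positivity
    have h5 : (0 : ℝ) ≤ r := Nat.cast_nonneg _
    rw [h1]
    linarith
  have hreg := LayerVertex.layerGraph_isRegularOfDegree (M := M) (by omega) hp3
    (by omega : r ≤ m)
  rw [hkmr] at hreg
  have : Nonempty (LayerVertex M p m) := ⟨⟨0, false, 0, 0, 0⟩⟩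
  obtain ⟨n, G, hn, hG, hprob⟩ := exists_fin_regular_graph (LayerVertex.layerGraph M p m r) hreg
    (1 / 2) ((k : ℝ) / 3 + α * k)
  refine ⟨n, G, hn, hG, ?_⟩
  rw [hprob]
  exact LayerVertex.le_subgraphProb_layerGraph (by omega) hp3 (by omega) hγ hγ_half hpγ2 hr' hsmall
    hheavy hnuc hx
end

section
/- For every finite simple graph G, the expected chromatic number of the random subgraph G_{1/2} satisfies E[χ(G_{1/2})] ≥ √(χ(G)). -/
open scoped Classical

/-- Expected chromatic number of the random subgraph of `G` in which each edge of `G` is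
retained independently with probability `p`. -/
noncomputable def expectedChromatic {V : Type} [Fintype V] (G : SimpleGraph V) (p : ℝ) : ℝ :=
  ∑ s ∈ G.edgeSet.toFinset.powerset,
    p ^ s.card * (1 - p) ^ (G.edgeSet.toFinset.card - s.card) *
      ((SimpleGraph.fromEdgeSet (↑s : Set (Sym2 V))).chromaticNumber.toNat : ℝ)

/-- The chromatic number is submultiplicative under covering the edges by two graphs. -/
theorem SimpleGraph.chromaticNumber_toNat_le_mul_of_le_sup {V : Type*} [Finite V]
    {G H K : SimpleGraph V} (h : G ≤ H ⊔ K) :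
    G.chromaticNumber.toNat ≤ H.chromaticNumber.toNat * K.chromaticNumber.toNat := by
  have := Fintype.ofFinite V
  have hcol (L : SimpleGraph V) : L.Colorable L.chromaticNumber.toNat :=
    SimpleGraph.colorable_chromaticNumber L.colorable_of_fintype
  obtain ⟨c⟩ := hcol H
  obtain ⟨d⟩ := hcol K
  let e : G.Coloring (Fin H.chromaticNumber.toNat × Fin K.chromaticNumber.toNat) :=
    SimpleGraph.Coloring.mk (fun v => (c v, d v)) fun {v w} hvw heq => by
      rw [Prod.mk.injEq] at heq
      rcases h hvw with hH | hK
      · exact c.valid hH heq.1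
      · exact d.valid hK heq.2
  have hle := e.colorable.chromaticNumber_le
  rw [Fintype.card_prod, Fintype.card_fin, Fintype.card_fin] at hle
  exact ENat.toNat_le_of_le_natCast hle

/-- For every finite graph `G`, `E[χ(G_{1/2})] ≥ √(χ(G))`. -/
theorem expected_chromatic_ge_sqrt {V : Type} [Fintype V] (G : SimpleGraph V) :
    Real.sqrt (G.chromaticNumber.toNat : ℝ) ≤ expectedChromatic G (1/2) := by
  unfold expectedChromatic
  set E := G.edgeSet.toFinset with hE
  let a : Finset (Sym2 V) → ℝ := fun s =>
    ((SimpleGraph.fromEdgeSet (↑s : Set (Sym2 V))).chromaticNumber.toNat : ℝ)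
  have hsum : ∑ s ∈ E.powerset, (1 / 2 : ℝ) ^ s.card * (1 - 1 / 2) ^ (E.card - s.card) * a s
      = (1 / 2) ^ E.card * ∑ s ∈ E.powerset, a s := by
    rw [Finset.mul_sum]
    refine Finset.sum_congr rfl fun s hs => ?_
    have hc := Finset.card_le_card (Finset.mem_powerset.mp hs)
    rw [show (1 - 1 / 2 : ℝ) = 1 / 2 by norm_num, ← pow_add, Nat.add_sub_cancel' hc]
  have hcompl : ∑ s ∈ E.powerset, a (E \ s) = ∑ s ∈ E.powerset, a s :=
    Finset.sum_nbij' (E \ ·) (E \ ·) (by simp) (by simp)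
      (fun s hs => Finset.sdiff_sdiff_eq_self (Finset.mem_powerset.mp hs))
      (fun s hs => Finset.sdiff_sdiff_eq_self (Finset.mem_powerset.mp hs)) (fun _ _ => rfl)
  have hpair : ∀ s ∈ E.powerset, 2 * √(G.chromaticNumber.toNat : ℝ) ≤ a s + a (E \ s) := by
    intro s _
    have hle : G ≤ SimpleGraph.fromEdgeSet (s : Set (Sym2 V)) ⊔
        SimpleGraph.fromEdgeSet ((E \ s : Finset (Sym2 V)) : Set (Sym2 V)) := by
      intro v w hvw
      by_cases hs : s(v, w) ∈ s <;> simp [hE, hs, hvw, hvw.ne]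
    have hmul : (G.chromaticNumber.toNat : ℝ) ≤ a s * a (E \ s) := by
      simp only [a]
      exact_mod_cast SimpleGraph.chromaticNumber_toNat_le_mul_of_le_sup hle
    have h₁ : 0 ≤ a s := Nat.cast_nonneg _
    have h₂ : 0 ≤ a (E \ s) := Nat.cast_nonneg _
    have : √(G.chromaticNumber.toNat : ℝ) ≤ (a s + a (E \ s)) / 2 := by
      rw [Real.sqrt_le_left (by positivity)]
      nlinarith [sq_nonneg (a s - a (E \ s))]
    linarith
  have htotal := Finset.sum_le_sum hpair
  rw [Finset.sum_add_distrib, hcompl, Finset.sum_const, Finset.card_powerset,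
    nsmul_eq_mul] at htotal
  push_cast at htotal
  have hpow : (1 / 2 : ℝ) ^ E.card * 2 ^ E.card = 1 := by
    rw [← mul_pow]; norm_num
  refine le_of_le_of_eq ?_ hsum.symm
  calc √(G.chromaticNumber.toNat : ℝ)
      = (1 / 2) ^ E.card * (2 ^ E.card * √(G.chromaticNumber.toNat : ℝ)) := by
        rw [← mul_assoc, hpow, one_mul]
    _ ≤ (1 / 2) ^ E.card * ∑ s ∈ E.powerset, a s := by
        gcongr
        linarith
end

section
/- For every finite simple graph G and every positive integer r, the expected chromatic number of the random subgraph G_{1/r} satisfies E[χ(G_{1/r})] ≥ χ(G)^{1/r}. -/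
open scoped Classical

namespace SimpleGraph

/-- If every edge of `G` lies in one of the graphs `H i`, then `χ(G) ≤ ∏ i, χ(H i)`. -/
theorem chromaticNumber_toNat_le_prod {V ι : Type*} [Finite V] [Fintype ι] (G : SimpleGraph V)
    (H : ι → SimpleGraph V) (h : ∀ u v, G.Adj u v → ∃ i, (H i).Adj u v) :
    G.chromaticNumber.toNat ≤ ∏ i, (H i).chromaticNumber.toNat := by
  have hcol : ∀ i, Nonempty ((H i).Coloring (Fin (H i).chromaticNumber.toNat)) := fun i ↦
    colorable_chromaticNumber_of_fintype (H i)
  have C := fun i ↦ (hcol i).some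
  let D : G.Coloring (∀ i, Fin (H i).chromaticNumber.toNat) :=
    Coloring.mk (fun v i ↦ C i v) fun {u v} huv heq ↦ by
      obtain ⟨i, hi⟩ := h u v huv
      exact (C i).valid hi (congrFun heq i)
  have hle := D.colorable.chromaticNumber_le
  rw [Fintype.card_pi] at hle
  simpa using ENat.toNat_le_of_le_natCast hle

end SimpleGraph

/-- The number of functions `E → ι` whose fibre over `i` is `s`. -/
theorem card_filter_fiber_eq {α ι : Type*} [Fintype ι] [DecidableEq ι] (E s : Finset α) (hs : s ⊆ E)
    (i : ι) :
    (Finset.univ.filter fun f : E → ι ↦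
      (Finset.univ.filter fun e ↦ f e = i).map (Function.Embedding.subtype _) = s).card =
      (Fintype.card ι - 1) ^ (E.card - s.card) := by
  have hset : (Finset.univ.filter fun f : E → ι ↦
      (Finset.univ.filter fun e ↦ f e = i).map (Function.Embedding.subtype _) = s) =
      Fintype.piFinset fun e : E ↦ if (e : α) ∈ s then {i} else Finset.univ.erase i := by
    ext f
    simp only [Finset.mem_filter, Finset.mem_univ, true_and, Fintype.mem_piFinset]
    constructor
    · rintro rfl e
      by_cases he : f e = i <;> simp [he]
    · intro h
      ext a
      simp only [Finset.mem_map, Finset.mem_filter, Finset.mem_univ, true_and,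
        Function.Embedding.subtype_apply]
      constructor
      · rintro ⟨e, he, rfl⟩
        by_contra hes
        have := h e
        simp [hes, he] at this
      · intro ha
        have := h ⟨a, hs ha⟩
        exact ⟨⟨a, hs ha⟩, by simpa [ha] using this, rfl⟩
  rw [hset, Fintype.card_piFinset, ← Finset.card_sdiff_of_subset hs]
  rw [Finset.prod_coe_sort E fun e ↦ (if e ∈ s then {i} else Finset.univ.erase i : Finset ι).card]
  simp only [apply_ite Finset.card, Finset.prod_ite, Finset.card_singleton, Finset.prod_const,
    one_pow, one_mul, Finset.card_erase_of_mem (Finset.mem_univ i), Finset.card_univ]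
  rw [Finset.filter_notMem_eq_sdiff]

/-- Averaging `X` over the fibre at `i` of a uniformly random function `E → ι` is the same as
averaging it over a binomial random subset of `E` with density `1 / |ι|`. -/
theorem sum_fiber_eq_sum_powerset {α ι : Type*} [Fintype ι] [DecidableEq ι] (E : Finset α) (X : Finset α → ℝ)
    (i : ι) :
    ∑ f : E → ι, X ((Finset.univ.filter fun e ↦ f e = i).map (Function.Embedding.subtype _)) =
      (Fintype.card ι : ℝ) ^ E.card * ∑ s ∈ E.powerset, (1 / (Fintype.card ι : ℝ)) ^ s.card *
        (1 - 1 / (Fintype.card ι : ℝ)) ^ (E.card - s.card) * X s := by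
  have hpos : 0 < Fintype.card ι := Fintype.card_pos_iff.2 ⟨i⟩
  have hne : (Fintype.card ι : ℝ) ≠ 0 := by positivity
  rw [← Finset.sum_fiberwise_of_maps_to (t := E.powerset)
    (g := fun f : E → ι ↦
      (Finset.univ.filter fun e ↦ f e = i).map (Function.Embedding.subtype _)), Finset.mul_sum]
  · refine Finset.sum_congr rfl fun s hs ↦ ?_
    have hsE := Finset.mem_powerset.1 hs
    rw [Finset.sum_congr rfl (g := fun _ ↦ X s)
      (fun f hf ↦ by rw [(Finset.mem_filter.1 hf).2]), Finset.sum_const,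
      card_filter_fiber_eq E s hsE, nsmul_eq_mul, ← mul_assoc]
    congr 1
    have hcard : s.card + (E.card - s.card) = E.card :=
      Nat.add_sub_cancel' (Finset.card_le_card hsE)
    calc (((Fintype.card ι - 1) ^ (E.card - s.card) : ℕ) : ℝ)
        = ((Fintype.card ι : ℝ) - 1) ^ (E.card - s.card) := by
          rw [Nat.cast_pow, Nat.cast_pred hpos]
      _ = ((Fintype.card ι : ℝ) * (1 / Fintype.card ι)) ^ s.card *
          ((Fintype.card ι : ℝ) * (1 - 1 / Fintype.card ι)) ^ (E.card - s.card) := by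
          rw [mul_one_div_cancel hne, one_pow, one_mul, mul_sub, mul_one_div_cancel hne, mul_one]
      _ = _ := by
          conv_rhs => rw [← hcard, pow_add, Nat.add_sub_cancel_left]
          rw [mul_pow, mul_pow]
          ring
  · intro f _
    rw [Finset.mem_powerset]
    intro a ha
    obtain ⟨e, -, rfl⟩ := Finset.mem_map.1 ha
    exact e.2

/-- For every finite graph `G` and positive integer `r`, `E[χ(G_{1/r})] ≥ χ(G)^{1/r}`. -/
theorem expected_chromatic_ge_rpow {V : Type} [Fintype V] (G : SimpleGraph V)
    (r : ℕ) (hr : 0 < r) :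
    ((G.chromaticNumber.toNat : ℝ)) ^ ((1 : ℝ) / r) ≤ expectedChromatic G (1 / (r : ℝ)) := by
  have hr' : (0 : ℝ) < r := by exact_mod_cast hr
  set E := G.edgeSet.toFinset with hE
  let X : Finset (Sym2 V) → ℝ := fun s ↦
    ((SimpleGraph.fromEdgeSet (↑s : Set (Sym2 V))).chromaticNumber.toNat : ℝ)
  let S : (E → Fin r) → Fin r → Finset (Sym2 V) := fun f i ↦
    (Finset.univ.filter fun e ↦ f e = i).map (Function.Embedding.subtype _)
  have hmean : ∀ f : E → Fin r,
      (G.chromaticNumber.toNat : ℝ) ^ ((1 : ℝ) / r) ≤ ∑ i, 1 / (r : ℝ) * X (S f i) := by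
    intro f
    have hprod : (G.chromaticNumber.toNat : ℝ) ≤ ∏ i, X (S f i) := by
      have := G.chromaticNumber_toNat_le_prod
        (fun i ↦ SimpleGraph.fromEdgeSet (↑(S f i) : Set (Sym2 V))) fun u v huv ↦ by
          have he : s(u, v) ∈ E := by simpa [hE] using huv
          exact ⟨f ⟨_, he⟩, (SimpleGraph.fromEdgeSet_adj _).2
            ⟨Finset.mem_coe.2 (Finset.mem_map.2 ⟨⟨_, he⟩, by simp, rfl⟩), huv.ne⟩⟩
      simp only [X]
      exact_mod_cast this
    calc (G.chromaticNumber.toNat : ℝ) ^ ((1 : ℝ) / r)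
        ≤ (∏ i, X (S f i)) ^ ((1 : ℝ) / r) := by gcongr
      _ = ∏ i, X (S f i) ^ ((1 : ℝ) / r) :=
          (Real.finsetProd_rpow _ _ (fun i _ ↦ Nat.cast_nonneg _) _).symm
      _ ≤ ∑ i, 1 / (r : ℝ) * X (S f i) :=
          Real.geom_mean_le_arith_mean_weighted _ _ _ (fun _ _ ↦ by positivity)
            (by simp [hr'.ne']) (fun i _ ↦ Nat.cast_nonneg _)
  have hsum := Finset.sum_le_sum fun f (_ : f ∈ Finset.univ) ↦ hmean f
  rw [Finset.sum_comm] at hsum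
  have hfiber : ∀ i, ∑ f, X (S f i) = (r : ℝ) ^ E.card * expectedChromatic G (1 / (r : ℝ)) :=
    fun i ↦ by
      have h := sum_fiber_eq_sum_powerset E X i
      simp only [Fintype.card_fin] at h
      rw [expectedChromatic]
      convert h
  simp only [← Finset.mul_sum, hfiber, Finset.sum_const, Finset.card_univ, Fintype.card_fun,
    Fintype.card_fin, Fintype.card_coe, nsmul_eq_mul, Nat.cast_pow] at hsum
  rw [mul_left_comm, ← mul_assoc (1 / (r : ℝ)), one_div_mul_cancel hr'.ne', one_mul] at hsum
  exact le_of_mul_le_mul_left hsum (by positivity)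
end
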